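/- arXiv:math/0211051 — 4 statements merged into one kernel-verified Lean document; each statement's English description precedes it below -/
import Mathlib

section
/- Let H be an N×N Jacobi matrix with positive off-diagonals, and let μ_1 ≤ μ_2 ≤ ... ≤ μ_{N-1} be the eigenvalues of the principal submatrix H_n obtained by deleting the n-th row and column, and λ_1 < λ_2 < ... < λ_N the eigenvalues of H. Then the interlacing property λ_1 < μ_1 ≤ λ_2 ≤ μ_2 ≤ ... ≤ μ_{N-1} < λ_N holds; moreover λ_j < μ_j < λ_{j+1} whenever μ_j is not a common eigenvalue of both diagonal blocks H_- and H_+ of H_n. -/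
open Matrix Polynomial BigOperators

/-- A Jacobi matrix: real symmetric tridiagonal with positive off-diagonal entries. -/
def IsJacobi {N : ℕ} (H : Matrix (Fin N) (Fin N) ℝ) : Prop :=
  H.IsSymm ∧ (∀ i j : Fin N, (i : ℕ) + 1 < (j : ℕ) → H i j = 0) ∧
    (∀ i j : Fin N, (j : ℕ) = (i : ℕ) + 1 → 0 < H i j)

/-- The principal block of `H` on indices `0, …, n-1` (paper: `H₋`). -/
def Jminus {N : ℕ} (H : Matrix (Fin N) (Fin N) ℝ) (n : Fin N) :
    Matrix (Fin (n : ℕ)) (Fin (n : ℕ)) ℝ :=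
  H.submatrix (fun i => ⟨i, i.isLt.trans n.isLt⟩) (fun i => ⟨i, i.isLt.trans n.isLt⟩)

/-- The principal block of `H` on indices `n+1, …, N-1` (paper: `H₊`). -/
def Jplus {N : ℕ} (H : Matrix (Fin N) (Fin N) ℝ) (n : Fin N) :
    Matrix (Fin (N - (n : ℕ) - 1)) (Fin (N - (n : ℕ) - 1)) ℝ :=
  H.submatrix (fun i => ⟨(n : ℕ) + 1 + i, by have := i.isLt; omega⟩)
    (fun i => ⟨(n : ℕ) + 1 + i, by have := i.isLt; omega⟩)

/-- `H` with the `n`-th row and column deleted. -/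
def Jdel {N : ℕ} (H : Matrix (Fin N) (Fin N) ℝ) (n : Fin N) :
    Matrix (Fin (N - 1)) (Fin (N - 1)) ℝ :=
  H.submatrix
    (fun i => if h : (i : ℕ) < (n : ℕ) then ⟨i, h.trans n.isLt⟩
      else ⟨(i : ℕ) + 1, by have := i.isLt; omega⟩)
    (fun i => if h : (i : ℕ) < (n : ℕ) then ⟨i, h.trans n.isLt⟩
      else ⟨(i : ℕ) + 1, by have := i.isLt; omega⟩)

section Separation

variable {ι κ : Type*} [Fintype ι] [Fintype κ]

theorem card_subtype_eq_of_map_eq {α : Type*} {a c : ι → α}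
    (h : Finset.univ.val.map a = Finset.univ.val.map c) (p : α → Prop) [DecidablePred p] :
    Fintype.card {i // p (a i)} = Fintype.card {i // p (c i)} := by
  have := congrArg (Multiset.countP p) h
  rw [Multiset.countP_map, Multiset.countP_map] at this
  rw [Fintype.card_subtype, Fintype.card_subtype]
  exact this

theorem mem_of_map_eq {α : Type*} {a c : ι → α}
    (h : Finset.univ.val.map a = Finset.univ.val.map c) (i : ι) : ∃ j, c j = a i := by
  have : a i ∈ Finset.univ.val.map c := h ▸ Multiset.mem_map_of_mem a (Finset.mem_univ i)
  simpa using this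

variable [DecidableEq ι] [DecidableEq κ]

/-- An orthogonal diagonalization turns the quadratic form into a weighted sum of squares. -/
theorem dotProduct_mulVec_conj_diagonal (U : Matrix ι ι ℝ) (a : ι → ℝ) (x : ι → ℝ) :
    x ⬝ᵥ ((U * diagonal a * Uᵀ) *ᵥ x) = ∑ i, a i * (Uᵀ *ᵥ x) i ^ 2 := by
  rw [Matrix.mul_assoc, ← mulVec_mulVec, dotProduct_mulVec, ← mulVec_transpose, ← mulVec_mulVec]
  simp only [dotProduct, mulVec_diagonal]
  exact Finset.sum_congr rfl fun i _ => by ring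

theorem dotProduct_self_eq_sum_sq {U : Matrix ι ι ℝ} (hU : U * Uᵀ = 1) (x : ι → ℝ) :
    x ⬝ᵥ x = ∑ i, (Uᵀ *ᵥ x) i ^ 2 := by
  simpa [hU] using dotProduct_mulVec_conj_diagonal U 1 x

/-- Poincaré separation: if fewer eigenvalues of `A` lie below `l` than eigenvalues of the
compression `Eᵀ A E` are at most `m`, then `l ≤ m`. -/
theorem le_of_card_lt_of_compression {U : Matrix ι ι ℝ} {V : Matrix κ κ ℝ} {E : Matrix ι κ ℝ}
    {a : ι → ℝ} {b : κ → ℝ} (hU : U * Uᵀ = 1) (hV : V * Vᵀ = 1) (hE : Eᵀ * E = 1)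
    (hAB : V * diagonal b * Vᵀ = Eᵀ * (U * diagonal a * Uᵀ) * E) {l m : ℝ}
    (hcard : Fintype.card {i // a i < l} < Fintype.card {k // b k ≤ m}) : l ≤ m := by
  let L : (κ → ℝ) →ₗ[ℝ] ({i // a i < l} → ℝ) × ({k // ¬ b k ≤ m} → ℝ) :=
    ((LinearMap.funLeft ℝ ℝ Subtype.val).comp (Uᵀ * E).mulVecLin).prod
      ((LinearMap.funLeft ℝ ℝ Subtype.val).comp (Vᵀ).mulVecLin)
  have hker : LinearMap.ker L ≠ ⊥ := by
    apply LinearMap.ker_ne_bot_of_finrank_lt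
    simp only [Module.finrank_prod, Module.finrank_fintype_fun_eq_card]
    have h1 := Fintype.card_subtype_compl (fun k => b k ≤ m)
    have h2 := Fintype.card_subtype_le (fun k => b k ≤ m)
    omega
  obtain ⟨y, hy, hy0⟩ := (Submodule.ne_bot_iff _).1 hker
  have hya : ∀ i, a i < l → (Uᵀ *ᵥ (E *ᵥ y)) i = 0 := fun i hi => by
    rw [mulVec_mulVec]
    exact congrFun (congrArg Prod.fst (LinearMap.mem_ker.1 hy)) ⟨i, hi⟩
  have hyb : ∀ k, ¬ b k ≤ m → (Vᵀ *ᵥ y) k = 0 := fun k hk =>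
    congrFun (congrArg Prod.snd (LinearMap.mem_ker.1 hy)) ⟨k, hk⟩
  have hpos : 0 < y ⬝ᵥ y := by
    refine lt_of_le_of_ne (Finset.sum_nonneg fun i _ => mul_self_nonneg _) fun h => hy0 ?_
    exact dotProduct_self_eq_zero.1 h.symm
  have hnorm : (E *ᵥ y) ⬝ᵥ (E *ᵥ y) = y ⬝ᵥ y := by
    rw [dotProduct_mulVec, ← mulVec_transpose, mulVec_mulVec, hE, one_mulVec]
  have hform : (E *ᵥ y) ⬝ᵥ ((U * diagonal a * Uᵀ) *ᵥ (E *ᵥ y)) =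
      y ⬝ᵥ ((V * diagonal b * Vᵀ) *ᵥ y) := by
    rw [hAB, Matrix.mul_assoc Eᵀ, ← mulVec_mulVec _ Eᵀ, dotProduct_mulVec y, ← mulVec_transpose,
      transpose_transpose, mulVec_mulVec _ _ E]
  have hlow : l * (y ⬝ᵥ y) ≤ y ⬝ᵥ ((V * diagonal b * Vᵀ) *ᵥ y) := by
    rw [← hform, ← hnorm, dotProduct_mulVec_conj_diagonal, dotProduct_self_eq_sum_sq hU,
      Finset.mul_sum]
    refine Finset.sum_le_sum fun i _ => ?_
    rcases lt_or_ge (a i) l with h | h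
    · simp [hya i h]
    · gcongr
  have hupp : y ⬝ᵥ ((V * diagonal b * Vᵀ) *ᵥ y) ≤ m * (y ⬝ᵥ y) := by
    rw [dotProduct_mulVec_conj_diagonal, dotProduct_self_eq_sum_sq hV, Finset.mul_sum]
    refine Finset.sum_le_sum fun k _ => ?_
    by_cases h : b k ≤ m
    · gcongr
    · simp [hyb k h]
  exact le_of_mul_le_mul_right (hlow.trans hupp) hpos

/-- A real symmetric matrix is orthogonally diagonalizable, the diagonal carrying the roots of
the characteristic polynomial. -/
theorem exists_orthogonal_diagonalization {A : Matrix ι ι ℝ} (hA : A.IsSymm) {c : ι → ℝ}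
    (hc : A.charpoly = ∏ i, (X - C (c i))) :
    ∃ (U : Matrix ι ι ℝ) (a : ι → ℝ), U * Uᵀ = 1 ∧ A = U * diagonal a * Uᵀ ∧
      Finset.univ.val.map a = Finset.univ.val.map c := by
  have hA' : A.IsHermitian := by rwa [IsHermitian, conjTranspose_eq_transpose_of_trivial]
  refine ⟨hA'.eigenvectorUnitary, hA'.eigenvalues, ?_, ?_, ?_⟩
  · have := Unitary.coe_mul_star_self hA'.eigenvectorUnitary
    rwa [Unitary.coe_star, star_eq_conjTranspose, conjTranspose_eq_transpose_of_trivial] at this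
  · have := hA'.spectral_theorem
    rw [Unitary.conjStarAlgAut_apply, star_eq_conjTranspose,
      conjTranspose_eq_transpose_of_trivial] at this
    exact this
  · have h := hA'.roots_charpoly_eq_eigenvalues
    have hroots := Polynomial.roots_multiset_prod_X_sub_C (Finset.univ.val.map c)
    rw [Multiset.map_map] at hroots
    exact (h.symm.trans (congrArg Polynomial.roots hc)).trans hroots

/-- If `± (A - l)` has only nonnegative eigenvalues, then a vector on which its quadratic form
vanishes is an eigenvector of `A`. -/
theorem mulVec_eq_smul_of_extremal {U : Matrix ι ι ℝ} {a : ι → ℝ} (hU : U * Uᵀ = 1) {l s : ℝ}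
    (hs : s ≠ 0) (ha : ∀ i, 0 ≤ s * (a i - l)) {v : ι → ℝ}
    (hv : v ⬝ᵥ ((U * diagonal a * Uᵀ) *ᵥ v) = l * (v ⬝ᵥ v)) :
    (U * diagonal a * Uᵀ) *ᵥ v = l • v := by
  rw [dotProduct_mulVec_conj_diagonal, dotProduct_self_eq_sum_sq hU] at hv
  have h0 : ∑ i, s * (a i - l) * (Uᵀ *ᵥ v) i ^ 2 = 0 := by
    calc _ = s * (∑ i, a i * (Uᵀ *ᵥ v) i ^ 2 - l * ∑ i, (Uᵀ *ᵥ v) i ^ 2) := by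
          rw [Finset.mul_sum, ← Finset.sum_sub_distrib, Finset.mul_sum]
          exact Finset.sum_congr rfl fun i _ => by ring
      _ = 0 := by rw [hv]; ring
  rw [Finset.sum_eq_zero_iff_of_nonneg fun i _ => mul_nonneg (ha i) (sq_nonneg _)] at h0
  have h1 : diagonal a *ᵥ (Uᵀ *ᵥ v) = l • (Uᵀ *ᵥ v) := by
    ext i
    have := h0 i (Finset.mem_univ i)
    rw [mulVec_diagonal, Pi.smul_apply, smul_eq_mul]
    rcases mul_eq_zero.1 this with h | h
    · rw [sub_eq_zero.1 ((mul_eq_zero.1 h).resolve_left hs)]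
    · simp [pow_eq_zero_iff] at h
      simp [h]
  rw [← mulVec_mulVec, ← mulVec_mulVec, h1, mulVec_smul, mulVec_mulVec, hU, one_mulVec]

theorem mem_spectrum_iff_exists_mulVec {M : Matrix ι ι ℝ} {r : ℝ} :
    r ∈ spectrum ℝ M ↔ ∃ v, v ≠ 0 ∧ M *ᵥ v = r • v := by
  rw [mem_spectrum_iff_isRoot_charpoly, IsRoot.def, eval_charpoly, ← exists_mulVec_eq_zero_iff]
  refine exists_congr fun v => and_congr_right fun _ => ?_
  rw [sub_mulVec, sub_eq_zero, eq_comm, scalar_apply, ← smul_one_eq_diagonal, smul_mulVec,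
    one_mulVec]

theorem mem_spectrum_of_charpoly_eq_prod {M : Matrix ι ι ℝ} {c : ι → ℝ}
    (hc : M.charpoly = ∏ i, (X - C (c i))) (i : ι) : c i ∈ spectrum ℝ M := by
  rw [mem_spectrum_iff_isRoot_charpoly, hc, IsRoot.def, eval_prod]
  exact Finset.prod_eq_zero (Finset.mem_univ i) (by simp)

end Separation

section Jacobi

variable {N : ℕ} {H : Matrix (Fin N) (Fin N) ℝ}

theorem IsJacobi.apply_eq_zero (hH : IsJacobi H) {i j : Fin N}
    (h : (i : ℕ) + 1 < j ∨ (j : ℕ) + 1 < i) : H i j = 0 := by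
  rcases h with h | h
  · exact hH.2.1 i j h
  · rw [← hH.1.apply, hH.2.1 j i h]

theorem IsJacobi.apply_ne_zero (hH : IsJacobi H) {i j : Fin N}
    (h : (j : ℕ) = i + 1 ∨ (i : ℕ) = j + 1) : H i j ≠ 0 := by
  rcases h with h | h
  · exact (hH.2.2 i j h).ne'
  · rw [← hH.1.apply]
    exact (hH.2.2 j i h).ne'

theorem IsJacobi.eq_zero_of_vanish_ge (hH : IsJacobi H) {n : Fin N} {r : ℝ} {v : Fin N → ℝ}
    (hv : ∀ i, n ≤ i → v i = 0) (h : ∀ i ≤ n, (H *ᵥ v) i = r * v i) : v = 0 := by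
  have key : ∀ k : ℕ, ∀ i : Fin N, (n : ℕ) ≤ i + k → v i = 0 := by
    intro k
    induction k with
    | zero => exact fun i hi => hv i (Fin.le_def.2 (by omega))
    | succ k ih =>
      intro i hi
      by_cases hin : (n : ℕ) ≤ i
      · exact hv i hin
      have hrow := h ⟨i + 1, by omega⟩ (Fin.le_def.2 (by simp; omega))
      rw [ih ⟨i + 1, by omega⟩ (by simp; omega), mul_zero, mulVec, dotProduct,
        Finset.sum_eq_single i] at hrow
      · exact (mul_eq_zero.1 hrow).resolve_left (hH.apply_ne_zero (Or.inr rfl))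
      · intro j _ hj
        rcases lt_or_gt_of_ne (Fin.val_ne_of_ne hj) with hj | hj
        · rw [hH.apply_eq_zero (Or.inr (by simp; omega)), zero_mul]
        · rw [ih j (by omega), mul_zero]
      · simp
  exact funext fun i => key n i (by omega)

theorem IsJacobi.eq_zero_of_vanish_le (hH : IsJacobi H) {n : Fin N} {r : ℝ} {v : Fin N → ℝ}
    (hv : ∀ i ≤ n, v i = 0) (h : ∀ i, n ≤ i → (H *ᵥ v) i = r * v i) : v = 0 := by
  have key : ∀ k : ℕ, ∀ i : Fin N, (i : ℕ) ≤ n + k → v i = 0 := by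
    intro k
    induction k with
    | zero => exact fun i hi => hv i (Fin.le_def.2 (by omega))
    | succ k ih =>
      intro i hi
      by_cases hin : (i : ℕ) ≤ n
      · exact hv i hin
      have hrow := h ⟨i - 1, by omega⟩ (Fin.le_def.2 (by simp; omega))
      rw [ih ⟨i - 1, by omega⟩ (by simp; omega), mul_zero, mulVec, dotProduct,
        Finset.sum_eq_single i] at hrow
      · exact (mul_eq_zero.1 hrow).resolve_left (hH.apply_ne_zero (Or.inl (by simp; omega)))
      · intro j _ hj
        rcases lt_or_gt_of_ne (Fin.val_ne_of_ne hj) with hj | hj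
        · rw [ih j (by omega), mul_zero]
        · rw [hH.apply_eq_zero (Or.inl (by simp; omega)), zero_mul]
      · simp
  exact funext fun i => key N i (by omega)

/-- An eigenvector of `H` with vanishing `n`-th entry restricts to eigenvectors of both blocks. -/
theorem IsJacobi.mem_spectrum_blocks (hH : IsJacobi H) {n : Fin N} {r : ℝ} {x : Fin N → ℝ}
    (hx : x ≠ 0) (hxn : x n = 0) (h : H *ᵥ x = r • x) :
    r ∈ spectrum ℝ (Jminus H n) ∧ r ∈ spectrum ℝ (Jplus H n) := by
  have hrow : ∀ i, (H *ᵥ x) i = r * x i := fun i => by rw [h, Pi.smul_apply, smul_eq_mul]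
  constructor
  · let e : Fin (n : ℕ) → Fin N := fun i => ⟨i, i.isLt.trans n.isLt⟩
    have he : Function.Injective e := fun i j hij => Fin.ext (Fin.mk.inj hij)
    refine mem_spectrum_iff_exists_mulVec.2 ⟨x ∘ e, fun h0 => hx ?_, ?_⟩
    · refine hH.eq_zero_of_vanish_le (n := n) (fun i hi => ?_) fun i _ => hrow i
      rcases hi.lt_or_eq with hi | rfl
      · exact congrFun h0 ⟨i, hi⟩
      · exact hxn
    · ext i
      refine Eq.trans ?_ (hrow (e i))
      refine Fintype.sum_of_injective e he _ _ (fun j hj => ?_) fun j => rfl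
      rcases lt_trichotomy j n with h' | rfl | h'
      · exact absurd ⟨⟨j, h'⟩, rfl⟩ hj
      · rw [hxn, mul_zero]
      · have h0 : H (e i) j = 0 := hH.apply_eq_zero (Or.inl (by simp only [e]; omega))
        exact mul_eq_zero_of_left h0 _
  · let e : Fin (N - (n : ℕ) - 1) → Fin N := fun i => ⟨(n : ℕ) + 1 + i, by omega⟩
    have he : Function.Injective e := fun i j hij => Fin.ext (by simpa [e] using hij)
    refine mem_spectrum_iff_exists_mulVec.2 ⟨x ∘ e, fun h0 => hx ?_, ?_⟩
    · refine hH.eq_zero_of_vanish_ge (n := n) (fun i hi => ?_) fun i _ => hrow i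
      rcases hi.lt_or_eq with hi | rfl
      · have := congrFun h0 ⟨i - n - 1, by omega⟩
        have hi' : e ⟨i - n - 1, by omega⟩ = i := Fin.ext (by simp [e]; omega)
        simpa [hi'] using this
      · exact hxn
    · ext i
      refine Eq.trans ?_ (hrow (e i))
      refine Fintype.sum_of_injective e he _ _ (fun j hj => ?_) fun j => rfl
      rcases lt_trichotomy j n with h' | rfl | h'
      · have h0 : H (e i) j = 0 := hH.apply_eq_zero (Or.inr (by simp only [e]; omega))
        exact mul_eq_zero_of_left h0 _
      · rw [hxn, mul_zero]
      · exact absurd ⟨⟨j - n - 1, by omega⟩, Fin.ext (by simp [e]; omega)⟩ hj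

/-- An eigenvector of the matrix with row and column `n` deleted yields one whose extension by
zero is not an eigenvector of `H`. -/
theorem IsJacobi.exists_defect_vector (hH : IsJacobi H) {n : Fin N} {r : ℝ} {x : Fin N → ℝ}
    (hx : x ≠ 0) (hxn : x n = 0) (h : ∀ i ≠ n, (H *ᵥ x) i = r * x i) :
    ∃ v : Fin N → ℝ, v n = 0 ∧ (∀ i ≠ n, (H *ᵥ v) i = r * v i) ∧ (H *ᵥ v) n ≠ 0 := by
  by_cases hn : (H *ᵥ x) n = 0
  swap
  · exact ⟨x, hxn, h, hn⟩
  have hrow : ∀ i, (H *ᵥ x) i = r * x i := fun i => by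
    rcases eq_or_ne i n with rfl | hi
    · rw [hn, hxn, mul_zero]
    · exact h i hi
  let v : Fin N → ℝ := fun i => if i < n then x i else 0
  have hv : ∀ i, n ≤ i → v i = 0 := fun i hi => if_neg hi.not_gt
  have hv' : ∀ i < n, v i = x i := fun i hi => if_pos hi
  have hvn : ∀ i ≠ n, (H *ᵥ v) i = r * v i := by
    intro i hi
    rcases lt_or_gt_of_ne hi with hi | hi
    · rw [hv' i hi, ← hrow i, mulVec, mulVec, dotProduct, dotProduct]
      refine Finset.sum_congr rfl fun j _ => ?_
      rcases lt_trichotomy j n with hj | rfl | hj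
      · rw [hv' j hj]
      · rw [hv j le_rfl, hxn]
      · rw [hH.apply_eq_zero (Or.inl (by omega)), zero_mul, zero_mul]
    · rw [hv i hi.le, mul_zero, mulVec, dotProduct]
      refine Finset.sum_eq_zero fun j _ => ?_
      rcases lt_or_ge j n with hj | hj
      · rw [hH.apply_eq_zero (Or.inr (by omega)), zero_mul]
      · rw [hv j hj, mul_zero]
  refine ⟨v, hv n le_rfl, hvn, fun h0 => hx ?_⟩
  have hv0 : v = 0 := by
    refine hH.eq_zero_of_vanish_ge hv (r := r) fun i _ => ?_
    rcases eq_or_ne i n with rfl | hi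
    · rw [h0, hv i le_rfl, mul_zero]
    · exact hvn i hi
  refine hH.eq_zero_of_vanish_le (n := n) (fun i hi => ?_) fun i _ => hrow i
  rcases hi.lt_or_eq with hi | rfl
  · rw [← hv' i hi, hv0, Pi.zero_apply]
  · exact hxn

/-- Every eigenvector of `H` vanishes at `n` as soon as a defect vector for the same eigenvalue
exists. -/
theorem apply_eq_zero_of_defect_vector (hH : H.IsSymm) {n : Fin N} {r : ℝ} {x v : Fin N → ℝ}
    (hx : H *ᵥ x = r • x) (hvn : v n = 0) (hv : ∀ i ≠ n, (H *ᵥ v) i = r * v i)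
    (hv0 : (H *ᵥ v) n ≠ 0) : x n = 0 := by
  have h1 : x ⬝ᵥ (H *ᵥ v) = r * (x ⬝ᵥ v) := by
    rw [dotProduct_mulVec, ← mulVec_transpose, hH, hx, smul_dotProduct, smul_eq_mul]
  have h2 : x ⬝ᵥ (H *ᵥ v - r • v) = x n * (H *ᵥ v) n := by
    rw [dotProduct, Finset.sum_eq_single n]
    · simp [hvn]
    · intro i _ hi
      simp [hv i hi]
    · simp
  rw [dotProduct_sub, dotProduct_smul, h1, smul_eq_mul, sub_self] at h2
  exact (mul_eq_zero.1 h2.symm).resolve_right hv0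

/-- The increasing embedding of indices that skips `n`. -/
def skipIndex (n : Fin N) (i : Fin (N - 1)) : Fin N :=
  if h : (i : ℕ) < (n : ℕ) then ⟨i, h.trans n.isLt⟩ else ⟨(i : ℕ) + 1, by have := i.isLt; omega⟩

theorem skipIndex_injective (n : Fin N) : Function.Injective (skipIndex n) := by
  intro i j h
  unfold skipIndex at h
  split_ifs at h <;> simp only [Fin.mk.injEq] at h <;> omega

theorem skipIndex_ne (n : Fin N) (i : Fin (N - 1)) : skipIndex n i ≠ n := by
  unfold skipIndex
  split_ifs <;> rw [Ne, Fin.ext_iff] <;> simp only <;> omega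

theorem exists_skipIndex_eq {n i : Fin N} (h : i ≠ n) : ∃ k, skipIndex n k = i := by
  have h' := Fin.val_ne_of_ne h
  rcases lt_or_gt_of_ne h' with hi | hi
  · exact ⟨⟨i, by omega⟩, by simp [skipIndex, hi]⟩
  · refine ⟨⟨i - 1, by omega⟩, Fin.ext ?_⟩
    rw [skipIndex, dif_neg (by simp; omega)]
    simp
    omega

/-- The coordinate inclusion extending vectors by zero at `n`. -/
def skipInclusion (n : Fin N) : Matrix (Fin N) (Fin (N - 1)) ℝ :=
  (1 : Matrix (Fin N) (Fin N) ℝ).submatrix id (skipIndex n)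

theorem transpose_skipInclusion_mulVec (n : Fin N) (w : Fin N → ℝ) (k : Fin (N - 1)) :
    ((skipInclusion n)ᵀ *ᵥ w) k = w (skipIndex n k) := by
  simp [skipInclusion, mulVec, dotProduct, one_apply]

theorem transpose_skipInclusion_mul_self (n : Fin N) :
    (skipInclusion n)ᵀ * skipInclusion n = 1 := by
  ext i j
  simp [skipInclusion, mul_apply, one_apply, (skipIndex_injective n).eq_iff, eq_comm]

theorem Jdel_eq_compression (H : Matrix (Fin N) (Fin N) ℝ) (n : Fin N) :
    Jdel H n = (skipInclusion n)ᵀ * H * skipInclusion n := by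
  ext i j
  simp [skipInclusion, mul_apply, one_apply]
  rfl

theorem IsJacobi.exists_defect_vector_of_mem_spectrum (hH : IsJacobi H) {n : Fin N} {r : ℝ}
    (hr : r ∈ spectrum ℝ (Jdel H n)) :
    ∃ v : Fin N → ℝ, v n = 0 ∧ (∀ i ≠ n, (H *ᵥ v) i = r * v i) ∧ (H *ᵥ v) n ≠ 0 := by
  obtain ⟨y, hy0, hy⟩ := mem_spectrum_iff_exists_mulVec.1 hr
  have hback : (skipInclusion n)ᵀ *ᵥ (skipInclusion n *ᵥ y) = y := by
    rw [mulVec_mulVec, transpose_skipInclusion_mul_self, one_mulVec]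
  refine hH.exists_defect_vector (x := skipInclusion n *ᵥ y) (fun h0 => hy0 ?_) ?_ fun i hi => ?_
  · rw [← hback, h0, mulVec_zero]
  · rw [mulVec, dotProduct]
    refine Finset.sum_eq_zero fun k _ => ?_
    simp [skipInclusion, one_apply, (skipIndex_ne n k).symm]
  · obtain ⟨k, rfl⟩ := exists_skipIndex_eq hi
    rw [← transpose_skipInclusion_mulVec n (H *ᵥ _),
      ← transpose_skipInclusion_mulVec n (skipInclusion n *ᵥ y), hback,
      mulVec_mulVec, mulVec_mulVec, ← Jdel_eq_compression, hy,
      Pi.smul_apply, smul_eq_mul]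

end Jacobi

/-- Interlacing: λ₁ < μ₁ ≤ λ₂ ≤ μ₂ ≤ … ≤ μ_{N-1} < λ_N, with strict
inequalities λⱼ < μⱼ < λⱼ₊₁ whenever μⱼ is not a common eigenvalue of both
blocks H₋ and H₊. -/
theorem jacobi_interlacing {N : ℕ} (hN : 1 < N) (H : Matrix (Fin N) (Fin N) ℝ)
    (n : Fin N) (hH : IsJacobi H)
    (lam : Fin N → ℝ) (mu : Fin (N - 1) → ℝ)
    (hlam : StrictMono lam) (hmu : Monotone mu)
    (hcl : H.charpoly = ∏ j, (X - C (lam j)))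
    (hcm : (Jdel H n).charpoly = ∏ j, (X - C (mu j))) :
    (∀ j : Fin (N - 1), lam ⟨j, by have := j.isLt; omega⟩ ≤ mu j ∧
      mu j ≤ lam ⟨(j : ℕ) + 1, by have := j.isLt; omega⟩) ∧
    lam ⟨0, by omega⟩ < mu ⟨0, by omega⟩ ∧
    mu ⟨N - 2, by omega⟩ < lam ⟨N - 1, by omega⟩ ∧
    (∀ j : Fin (N - 1),
      ¬(mu j ∈ spectrum ℝ (Jminus H n) ∧ mu j ∈ spectrum ℝ (Jplus H n)) →
      lam ⟨j, by have := j.isLt; omega⟩ < mu j ∧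
        mu j < lam ⟨(j : ℕ) + 1, by have := j.isLt; omega⟩) := by
  have hBsymm : (Jdel H n).IsSymm := hH.1.submatrix _
  obtain ⟨U, a, hU, hHU, ha⟩ := exists_orthogonal_diagonalization hH.1 hcl
  obtain ⟨V, b, hV, hBV, hb⟩ := exists_orthogonal_diagonalization hBsymm hcm
  have hE := transpose_skipInclusion_mul_self n
  have hcomp : V * diagonal b * Vᵀ =
      (skipInclusion n)ᵀ * (U * diagonal a * Uᵀ) * skipInclusion n := by
    rw [← hBV, ← hHU, Jdel_eq_compression]
  have hweak : ∀ j : Fin (N - 1), lam ⟨j, by have := j.isLt; omega⟩ ≤ mu j ∧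
      mu j ≤ lam ⟨(j : ℕ) + 1, by have := j.isLt; omega⟩ := by
    intro j
    constructor
    · refine le_of_card_lt_of_compression hU hV hE hcomp ?_
      rw [card_subtype_eq_of_map_eq ha (· < _), card_subtype_eq_of_map_eq hb (· ≤ _)]
      simp only [hlam.lt_iff_lt]
      refine lt_of_lt_of_le ?_ (Fintype.card_subtype_mono (· ≤ j) _ fun k hk => hmu hk)
      simp [Fintype.card_subtype, Finset.filter_gt_eq_Iio, Finset.filter_ge_eq_Iic]
    · refine neg_le_neg_iff.1 (le_of_card_lt_of_compression (a := -a) (b := -b) hU hV hE ?_ ?_)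
      · simpa [← diagonal_neg, Pi.neg_def] using hcomp
      · simp only [Pi.neg_apply, neg_lt_neg_iff, neg_le_neg_iff]
        rw [card_subtype_eq_of_map_eq ha (_ < ·), card_subtype_eq_of_map_eq hb (_ ≤ ·)]
        simp only [hlam.lt_iff_lt]
        refine lt_of_lt_of_le ?_ (Fintype.card_subtype_mono (j ≤ ·) _ fun k hk => hmu hk)
        simp [Fintype.card_subtype, Finset.filter_lt_eq_Ioi, Finset.filter_le_eq_Ici]
        omega
  have hdefect := fun j => hH.exists_defect_vector_of_mem_spectrum
    (mem_spectrum_of_charpoly_eq_prod hcm j)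
  have hextremal : ∀ (j : Fin (N - 1)) (s : ℝ), s ≠ 0 → (∀ i, 0 ≤ s * (lam i - mu j)) → False := by
    intro j s hs hpos
    obtain ⟨v, hvn, hv, hv0⟩ := hdefect j
    have hform : v ⬝ᵥ (H *ᵥ v) = mu j * (v ⬝ᵥ v) := by
      rw [dotProduct, dotProduct, Finset.mul_sum]
      refine Finset.sum_congr rfl fun i _ => ?_
      rcases eq_or_ne i n with rfl | hi
      · simp [hvn]
      · rw [hv i hi]
        ring
    rw [hHU] at hform hv0
    rw [mulVec_eq_smul_of_extremal hU hs (fun i => ?_) hform] at hv0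
    · exact hv0 (by simp [hvn])
    · obtain ⟨k, hk⟩ := mem_of_map_eq ha i
      rw [← hk]
      exact hpos k
  refine ⟨hweak, lt_of_le_of_ne (hweak ⟨0, by omega⟩).1 fun h => ?_,
    lt_of_le_of_ne ?_ fun h => ?_, fun j hj => ?_⟩
  · refine hextremal ⟨0, by omega⟩ 1 one_ne_zero fun i => ?_
    rw [← h, one_mul, sub_nonneg]
    exact hlam.monotone (Fin.le_def.2 (Nat.zero_le _))
  · exact (hweak ⟨N - 2, by omega⟩).2.trans_eq
      (congrArg lam (Fin.ext (by simp; omega)))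
  · refine hextremal ⟨N - 2, by omega⟩ (-1) (by norm_num) fun i => ?_
    rw [h, neg_one_mul, neg_sub, sub_nonneg]
    exact hlam.monotone (Fin.le_def.2 (by simp; omega))
  · have hne : ∀ k, lam k ≠ mu j := by
      intro k hk
      obtain ⟨v, hvn, hv, hv0⟩ := hdefect j
      obtain ⟨x, hx0, hx⟩ := mem_spectrum_iff_exists_mulVec.1
        (mem_spectrum_of_charpoly_eq_prod hcl k)
      rw [hk] at hx
      exact hj (hH.mem_spectrum_blocks hx0
        (apply_eq_zero_of_defect_vector hH.1 hx hvn hv hv0) hx)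
    exact ⟨(hweak j).1.lt_of_ne (hne _), (hweak j).2.lt_of_ne (hne _).symm⟩
end

section
/- Let H be an N×N Jacobi matrix with positive off-diagonals and spectra-disjoint blocks H_-, H_+ (after deleting row and column n). Then a_n² = Σ_{l=1}^{N-n} β_l^+, where β_l^+ := −(Π_{j=1}^N (μ_l^+ − λ_j)) / (Π_{k=1}^{n-1}(μ_l^+ − μ_k^-) · Π_{p≠l}(μ_l^+ − μ_p^+)) and λ_j, μ_k^-, μ_l^+ denote the eigenvalues of H, H_-, H_+. -/
open Matrix Polynomial BigOperators

/-- The `k × k` principal block of the infinite array `f` that starts at index `s`. -/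
def principalWindow {α : Type*} (f : ℕ → ℕ → α) (s k : ℕ) : Matrix (Fin k) (Fin k) α :=
  Matrix.of fun i j => f (s + i) (s + j)

/-- The three-term recurrence for determinants of tridiagonal matrices. -/
theorem det_principalWindow_add_two {R : Type*} [CommRing R] (f : ℕ → ℕ → R)
    (hu : ∀ i j, i + 1 < j → f i j = 0) (hl : ∀ i j, j + 1 < i → f i j = 0) (s k : ℕ) :
    (principalWindow f s (k + 2)).det =
      f s s * (principalWindow f (s + 1) (k + 1)).det -
        f s (s + 1) * f (s + 1) s * (principalWindow f (s + 2) k).det := by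
  have hdiag : (principalWindow f s (k + 2)).submatrix Fin.succ Fin.succ =
      principalWindow f (s + 1) (k + 1) := by
    ext i j
    simp [principalWindow, add_assoc, add_comm 1]
  have hminor : ((principalWindow f s (k + 2)).submatrix Fin.succ (Fin.succAbove 1)).det =
      f (s + 1) s * (principalWindow f (s + 2) k).det := by
    rw [det_succ_column_zero, Fin.sum_univ_succ, Finset.sum_eq_zero, add_zero]
    · congr 1
      · simp [principalWindow]
      · congr 1
        ext i j
        simp [principalWindow, Fin.succAbove, Fin.lt_def, add_assoc, add_comm 2]
    · intro i _
      have : f (s + (i + 1 + 1)) s = 0 := hl _ _ (by omega)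
      simp [principalWindow, this]
  rw [det_succ_row_zero, Fin.sum_univ_succ, Fin.sum_univ_succ, Finset.sum_eq_zero, add_zero]
  · simp only [Fin.succAbove_zero, Fin.succ_zero_eq_one, hdiag, hminor]
    simp [principalWindow]
    ring
  · intro i _
    have : f s (s + (i + 1 + 1)) = 0 := hu _ _ (by omega)
    simp [principalWindow, this]

/-- Splitting the determinant of a tridiagonal matrix at an off-diagonal entry. -/
theorem det_principalWindow_split {R : Type*} [CommRing R] (f : ℕ → ℕ → R)
    (hu : ∀ i j, i + 1 < j → f i j = 0) (hl : ∀ i j, j + 1 < i → f i j = 0) (k j s : ℕ) :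
    (principalWindow f s (j + k + 2)).det =
      (principalWindow f s (j + 1)).det * (principalWindow f (s + j + 1) (k + 1)).det -
        f (s + j) (s + j + 1) * f (s + j + 1) (s + j) *
          ((principalWindow f s j).det * (principalWindow f (s + j + 2) k).det) := by
  have rec2 := det_principalWindow_add_two f hu hl
  have det0 (s : ℕ) : (principalWindow f s 0).det = 1 := det_fin_zero
  have det1 (s : ℕ) : (principalWindow f s 1).det = f s s := by simp [principalWindow]
  induction j using Nat.twoStepInduction generalizing s with
  | zero => rw [zero_add, zero_add, add_zero, rec2, det0, det1, one_mul]
  | one =>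
    rw [show 1 + k + 2 = k + 1 + 2 by ring, rec2 s (k + 1), rec2 (s + 1) k, rec2 s 0, det0,
      zero_add, det1, det1]
    ring_nf
  | more j ih₀ ih₁ =>
    rw [show j + 2 + k + 2 = j + k + 2 + 2 by ring, rec2 s (j + k + 2), rec2 s (j + 1), rec2 s j,
      ih₀, show j + k + 2 + 1 = j + 1 + k + 2 by ring, ih₁,
      show s + 1 + (j + 1) = s + (j + 2) by ring, show s + 2 + j = s + (j + 2) by ring]
    ring

theorem charpoly_principalWindow {R : Type*} [CommRing R] (h : ℕ → ℕ → R) (s k : ℕ) :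
    (principalWindow h s k).charpoly =
      (principalWindow (fun i j => (if i = j then X else 0) - C (h i j)) s k).det := by
  rw [charpoly]
  congr 1
  ext1 i j
  simp [charmatrix_apply, principalWindow, diagonal_apply, Fin.ext_iff]

/-- Splitting the characteristic polynomial of a tridiagonal matrix at an off-diagonal entry. -/
theorem charpoly_principalWindow_split {R : Type*} [CommRing R] (h : ℕ → ℕ → R)
    (hu : ∀ i j, i + 1 < j → h i j = 0) (hl : ∀ i j, j + 1 < i → h i j = 0) (k j s : ℕ) :
    (principalWindow h s (j + k + 2)).charpoly =
      (principalWindow h s (j + 1)).charpoly * (principalWindow h (s + j + 1) (k + 1)).charpoly -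
        C (h (s + j) (s + j + 1) * h (s + j + 1) (s + j)) *
          ((principalWindow h s j).charpoly * (principalWindow h (s + j + 2) k).charpoly) := by
  simp only [charpoly_principalWindow]
  rw [det_principalWindow_split]
  · simp
  · intro i j hij
    simp [hu i j hij, show i ≠ j by omega]
  · intro i j hij
    simp [hl i j hij, show i ≠ j by omega]

/-- When σ(H₋) ∩ σ(H₊) = ∅, the residues
βₗ⁺ = −∏ⱼ(μₗ⁺ − λⱼ) / (∏ₖ(μₗ⁺ − μₖ⁻)·∏_{p≠l}(μₗ⁺ − μₚ⁺)) satisfy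
aₙ² = Σₗ βₗ⁺. -/
theorem jacobi_beta_plus {N : ℕ} (H : Matrix (Fin N) (Fin N) ℝ) (n : Fin N)
    (hH : IsJacobi H) (h1 : (n : ℕ) + 1 < N)
    (lam : Fin N → ℝ) (mum : Fin (n : ℕ) → ℝ) (mup : Fin (N - (n : ℕ) - 1) → ℝ)
    (hcl : H.charpoly = ∏ j, (X - C (lam j)))
    (hcm : (Jminus H n).charpoly = ∏ k, (X - C (mum k)))
    (hcp : (Jplus H n).charpoly = ∏ l, (X - C (mup l)))
    (hsm : Function.Injective mum) (hsp : Function.Injective mup)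
    (hdisj : ∀ k l, mum k ≠ mup l) :
    (H n ⟨(n : ℕ) + 1, by omega⟩) ^ 2 =
      ∑ l, -(∏ j, (mup l - lam j)) /
        ((∏ k, (mup l - mum k)) *
          ∏ p ∈ Finset.univ.erase l, (mup l - mup p)) := by
  obtain ⟨hsymm, htri, -⟩ := hH
  obtain ⟨n, hn⟩ := n
  simp only at h1 mum mup hcm hcp ⊢
  obtain ⟨k, hk⟩ : ∃ k, n + k + 2 = N := ⟨N - n - 2, by omega⟩
  have hm : k + 1 = N - n - 1 := by omega
  let h : ℕ → ℕ → ℝ := fun i j => if hij : i < N ∧ j < N then H ⟨i, hij.1⟩ ⟨j, hij.2⟩ else 0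
  have hval (i j : ℕ) (hi : i < N) (hj : j < N) : h i j = H ⟨i, hi⟩ ⟨j, hj⟩ := dif_pos ⟨hi, hj⟩
  have hu (i j : ℕ) (hij : i + 1 < j) : h i j = 0 := by
    by_cases hb : i < N ∧ j < N
    · rw [hval i j hb.1 hb.2]
      exact htri _ _ hij
    · exact dif_neg hb
  have hcomm (i j : ℕ) : h i j = h j i := by
    by_cases hb : i < N ∧ j < N
    · rw [hval i j hb.1 hb.2, hval j i hb.2 hb.1, hsymm.apply]
    · simp [h, hb, and_comm]
  have hH : principalWindow h 0 N = H := by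
    ext i j
    simp [principalWindow, hval]
  have hminus : principalWindow h 0 n = Jminus H ⟨n, hn⟩ := by
    ext i j
    simp only [principalWindow, of_apply, zero_add]
    exact hval _ _ _ _
  have hplus : principalWindow h (n + 1) (N - n - 1) = Jplus H ⟨n, hn⟩ := by
    ext i j
    exact hval _ _ _ _
  have split := charpoly_principalWindow_split h hu (fun i j hij => hcomm i j ▸ hu j i hij) k n 0
  rw [hk, hm, zero_add, hH, hminus, hplus, hcl, hcm, hcp, hcomm (n + 1) n, ← pow_two,
    hval n (n + 1) hn h1] at split
  set q := (principalWindow h (n + 2) k).charpoly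
  have hq : q.Monic := charpoly_monic _
  have hqdeg : q.natDegree = k := by simp [q]
  have hlead := Lagrange.leadingCoeff_eq_sum (s := Finset.univ) (hsp.injOn (s := _)) (P := q) (by
    rw [degree_eq_natDegree hq.ne_zero, hqdeg, Finset.card_univ, Fintype.card_fin, ← hm]
    norm_cast)
  rw [hq.leadingCoeff] at hlead
  rw [← mul_one (H _ _ ^ 2), hlead, Finset.mul_sum]
  refine Finset.sum_congr rfl fun l _ => ?_
  have heval := congrArg (eval (mup l)) split
  have hzero : ∏ p, (mup l - mup p) = 0 := Finset.prod_eq_zero (Finset.mem_univ l) (sub_self _)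
  simp only [eval_sub, eval_mul, eval_prod, eval_X, eval_C, hzero, mul_zero, zero_sub] at heval
  have hne : ∏ k, (mup l - mum k) ≠ 0 :=
    Finset.prod_ne_zero_iff.mpr fun k _ => sub_ne_zero.mpr (hdisj k l).symm
  rw [heval, neg_neg, mul_left_comm, mul_div_mul_left _ _ hne, mul_div_assoc]
end

section
/- Let H and H' be two N×N Jacobi matrices with positive off-diagonal entries, and fix an index n. Suppose σ(H) = σ(H'), σ(H_-) = σ(H'_-), σ(H_+) = σ(H'_+) (where the subscripted matrices are obtained by deleting row and column n), and suppose σ(H_-) ∩ σ(H_+) = ∅. Then H = H'. -/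
open Matrix Polynomial BigOperators

/-- The monic polynomials of the three-term recurrence with diagonal coefficients `b` and squared
off-diagonal coefficients `c` starting at index `s`. The indices are shifted by one:
`jacobiPoly b c s (k + 1)` has degree `k`, and `jacobiPoly b c s 0 = 0`. -/
noncomputable def jacobiPoly (b c : ℕ → ℝ) (s : ℕ) : ℕ → ℝ[X]
  | 0 => 0
  | 1 => 1
  | k + 2 => (X - C (b (s + k))) * jacobiPoly b c s (k + 1) - C (c (s + k)) * jacobiPoly b c s k

section jacobiPoly

variable (b c : ℕ → ℝ)

@[simp] theorem jacobiPoly_zero (s : ℕ) : jacobiPoly b c s 0 = 0 := by rw [jacobiPoly]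

@[simp] theorem jacobiPoly_one (s : ℕ) : jacobiPoly b c s 1 = 1 := by rw [jacobiPoly]

theorem jacobiPoly_add_two (s k : ℕ) : jacobiPoly b c s (k + 2) =
    (X - C (b (s + k))) * jacobiPoly b c s (k + 1) - C (c (s + k)) * jacobiPoly b c s k := by
  rw [jacobiPoly]

/-- Cutting the index range at `s + k`. -/
theorem jacobiPoly_split (s k l : ℕ) : jacobiPoly b c s (k + l + 1) =
    jacobiPoly b c s (k + 1) * jacobiPoly b c (s + k) (l + 1) -
      C (c (s + k)) * jacobiPoly b c s k * jacobiPoly b c (s + k + 1) l := by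
  induction l using Nat.strong_induction_on with
  | _ l ih =>
    match l with
    | 0 => simp
    | 1 =>
      have h := jacobiPoly_add_two b c (s + k) 0
      simp only [zero_add, add_zero, jacobiPoly_one, jacobiPoly_zero] at h
      rw [jacobiPoly_add_two, h, jacobiPoly_one]
      ring
    | l + 2 =>
      have h₀ := ih l (by omega)
      have h₁ := ih (l + 1) (by omega)
      rw [show k + (l + 1) + 1 = k + l + 2 by ring] at h₁
      rw [show k + (l + 2) + 1 = (k + l + 1) + 2 by ring, jacobiPoly_add_two,
        jacobiPoly_add_two b c (s + k) (l + 1), jacobiPoly_add_two b c (s + k + 1) l,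
        show k + l + 1 + 1 = k + l + 2 by ring, h₀, h₁,
        show s + (k + l + 1) = s + k + 1 + l by ring,
        show s + k + (l + 1) = s + k + 1 + l by ring]
      ring

/-- The recurrence that removes the first index instead of the last. -/
theorem jacobiPoly_add_two' (s k : ℕ) : jacobiPoly b c s (k + 2) =
    (X - C (b s)) * jacobiPoly b c (s + 1) (k + 1) -
      C (c (s + 1)) * jacobiPoly b c (s + 2) k := by
  have h := jacobiPoly_split b c s 1 k
  have h₂ := jacobiPoly_add_two b c s 0
  simp only [zero_add, add_zero, jacobiPoly_one, jacobiPoly_zero, mul_one, mul_zero,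
    sub_zero] at h₂
  rw [show 1 + k + 1 = k + 2 by ring, h₂, jacobiPoly_one, mul_one] at h
  exact h

theorem jacobiPoly_monic_and_degree (s k : ℕ) :
    (jacobiPoly b c s (k + 1)).Monic ∧ (jacobiPoly b c s (k + 1)).degree = k := by
  induction k using Nat.strong_induction_on with
  | _ k ih =>
    match k with
    | 0 => simp
    | k + 1 =>
      obtain ⟨hm, hd⟩ := ih k (by omega)
      have hlead : ((X - C (b (s + k))) * jacobiPoly b c s (k + 1)).degree =
          ((k + 1 : ℕ) : WithBot ℕ) := by
        rw [degree_mul, degree_X_sub_C, hd, add_comm]; rfl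
      have hlow : (C (c (s + k)) * jacobiPoly b c s k).degree <
          ((k + 1 : ℕ) : WithBot ℕ) := by
        match k with
        | 0 => simp
        | k + 1 =>
          rw [← smul_eq_C_mul]
          refine (degree_smul_le _ _).trans_lt ?_
          rw [(ih k (by omega)).2]
          exact_mod_cast (by omega)
      rw [← hlead] at hlow
      rw [jacobiPoly_add_two]
      exact ⟨((monic_X_sub_C _).mul hm).sub_of_left hlow,
        (degree_sub_eq_left_of_degree_lt hlow).trans hlead⟩

theorem jacobiPoly_monic (s k : ℕ) : (jacobiPoly b c s (k + 1)).Monic :=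
  (jacobiPoly_monic_and_degree b c s k).1

theorem degree_jacobiPoly_succ (s k : ℕ) : (jacobiPoly b c s (k + 1)).degree = k :=
  (jacobiPoly_monic_and_degree b c s k).2

theorem degree_C_mul_jacobiPoly_lt (γ : ℝ) (s k : ℕ) :
    (C γ * jacobiPoly b c s k).degree < k := by
  match k with
  | 0 => simp
  | k + 1 =>
    rw [← smul_eq_C_mul]
    refine (degree_smul_le _ _).trans_lt ?_
    rw [degree_jacobiPoly_succ]
    exact_mod_cast k.lt_succ_self

variable {b c}

theorem jacobiPoly_wronskian_pos (hc : ∀ i, 0 < c i) (s k : ℕ) (x : ℝ) :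
    0 < (derivative (jacobiPoly b c s (k + 2))).eval x * (jacobiPoly b c s (k + 1)).eval x -
      (jacobiPoly b c s (k + 2)).eval x * (derivative (jacobiPoly b c s (k + 1))).eval x := by
  induction k with
  | zero => simp [jacobiPoly_add_two b c s 0]
  | succ k ih =>
    have h := mul_pos (hc (s + (k + 1))) ih
    rw [jacobiPoly_add_two b c s (k + 1)]
    simp only [derivative_sub, derivative_mul, derivative_X, derivative_C, eval_sub, eval_mul,
      eval_add, eval_X, eval_C, eval_one, eval_zero, show k + 1 + 1 = k + 2 by ring]
    nlinarith [sq_nonneg ((jacobiPoly b c s (k + 2)).eval x)]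

theorem jacobiPoly_roots_nodup (hc : ∀ i, 0 < c i) (s k : ℕ) :
    (jacobiPoly b c s (k + 1)).roots.Nodup := by
  match k with
  | 0 => simp
  | k + 1 =>
    have h0 := (jacobiPoly_monic b c s (k + 1)).ne_zero
    refine Multiset.nodup_iff_count_le_one.2 fun x => ?_
    rw [count_roots]
    by_contra! hx
    obtain ⟨h₁, h₂⟩ := (one_lt_rootMultiplicity_iff_isRoot h0).1 hx
    have hw := jacobiPoly_wronskian_pos (b := b) hc s k x
    rw [show k + 2 = k + 1 + 1 by ring, h₁.eq_zero, h₂.eq_zero] at hw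
    simp at hw

variable {b' c' : ℕ → ℝ}

theorem eq_of_X_sub_C_mul_sub_eq {u v v' : ℝ[X]} {β β' : ℝ} (hv : v.degree < u.degree)
    (hv' : v'.degree < u.degree) (h : (X - C β) * u - v = (X - C β') * u - v') :
    β = β' ∧ v = v' := by
  have key : C (β' - β) * u = v - v' := by
    rw [C_sub]; linear_combination h
  have hβ : β' - β = 0 := by
    by_contra hne
    have hlt := (degree_sub_le v v').trans_lt (max_lt hv hv')
    rw [← key, degree_C_mul hne] at hlt
    exact lt_irrefl _ hlt
  rw [hβ, C_0, zero_mul] at key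
  exact ⟨(sub_eq_zero.1 hβ).symm, sub_eq_zero.1 key.symm⟩

theorem eq_of_C_mul_eq_C_mul_of_monic {p q : ℝ[X]} {γ γ' : ℝ} (hp : p.Monic) (hq : q.Monic)
    (hγ : γ ≠ 0) (h : C γ * p = C γ' * q) : γ = γ' ∧ p = q := by
  have hlead := congrArg leadingCoeff h
  simp only [leadingCoeff_mul, leadingCoeff_C, hp.leadingCoeff, hq.leadingCoeff, mul_one] at hlead
  subst hlead
  exact ⟨rfl, mul_left_cancel₀ (C_ne_zero.2 hγ) h⟩

/-- Two consecutive polynomials (the lower one up to a positive factor) determine the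
recurrence coefficients. -/
theorem jacobiPoly_inverse (hc : ∀ i, 0 < c i) (s k : ℕ) {γ γ' : ℝ} (hγ : 0 < γ)
    (h₁ : jacobiPoly b c s (k + 1) = jacobiPoly b' c' s (k + 1))
    (h₀ : C γ * jacobiPoly b c s k = C γ' * jacobiPoly b' c' s k) :
    (∀ j < k, b (s + j) = b' (s + j)) ∧ (∀ j, 0 < j → j < k → c (s + j) = c' (s + j)) ∧
      (0 < k → γ = γ') := by
  induction k generalizing γ γ' with
  | zero => simp
  | succ k ih =>
    obtain ⟨hγγ', h₀⟩ := eq_of_C_mul_eq_C_mul_of_monic (jacobiPoly_monic b c s k)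
      (jacobiPoly_monic b' c' s k) hγ.ne' h₀
    rw [jacobiPoly_add_two, jacobiPoly_add_two, ← h₀] at h₁
    obtain ⟨hb, hv⟩ := eq_of_X_sub_C_mul_sub_eq
      (by rw [degree_jacobiPoly_succ]; exact degree_C_mul_jacobiPoly_lt ..)
      (by rw [degree_jacobiPoly_succ]; exact degree_C_mul_jacobiPoly_lt ..) h₁
    obtain ⟨ihb, ihc, ihγ⟩ := ih (hc _) h₀ hv
    refine ⟨fun j hj => ?_, fun j hj hjk => ?_, fun _ => hγγ'⟩
    · rcases Nat.lt_succ_iff_lt_or_eq.1 hj with hj | rfl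
      exacts [ihb j hj, hb]
    · rcases Nat.lt_succ_iff_lt_or_eq.1 hjk with hjk | rfl
      exacts [ihc j hj hjk, ihγ hj]

/-- The analogue of `jacobiPoly_inverse` where the first index is removed. -/
theorem jacobiPoly_inverse' (hc : ∀ i, 0 < c i) (s k : ℕ) {γ γ' : ℝ} (hγ : 0 < γ)
    (h₁ : jacobiPoly b c s (k + 1) = jacobiPoly b' c' s (k + 1))
    (h₀ : C γ * jacobiPoly b c (s + 1) k = C γ' * jacobiPoly b' c' (s + 1) k) :
    (∀ j < k, b (s + j) = b' (s + j)) ∧ (∀ j, 0 < j → j < k → c (s + j) = c' (s + j)) ∧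
      (0 < k → γ = γ') := by
  induction k generalizing s γ γ' with
  | zero => simp
  | succ k ih =>
    obtain ⟨hγγ', h₀⟩ := eq_of_C_mul_eq_C_mul_of_monic (jacobiPoly_monic b c (s + 1) k)
      (jacobiPoly_monic b' c' (s + 1) k) hγ.ne' h₀
    rw [jacobiPoly_add_two', jacobiPoly_add_two', ← h₀] at h₁
    obtain ⟨hb, hv⟩ := eq_of_X_sub_C_mul_sub_eq
      (by rw [degree_jacobiPoly_succ]; exact degree_C_mul_jacobiPoly_lt ..)
      (by rw [degree_jacobiPoly_succ]; exact degree_C_mul_jacobiPoly_lt ..) h₁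
    obtain ⟨ihb, ihc, ihγ⟩ := ih (s + 1) (hc _) h₀ hv
    refine ⟨fun j hj => ?_, fun j hj hjk => ?_, fun _ => hγγ'⟩
    · match j with
      | 0 => exact hb
      | j + 1 =>
        rw [show s + (j + 1) = s + 1 + j by ring]
        exact ihb j (by omega)
    · match j with
      | 1 => exact ihγ (by omega)
      | j + 2 =>
        rw [show s + (j + 2) = s + 1 + (j + 1) by ring]
        exact ihc (j + 1) (by omega) (by omega)

end jacobiPoly

/-- `M` is tridiagonal with diagonal entries `b s, b (s + 1), …`, and the products of its
opposite off-diagonal entries are `c (s + 1), c (s + 2), …`. -/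
def IsTridiagWith (b c : ℕ → ℝ) (s : ℕ) {k : ℕ} (M : Matrix (Fin k) (Fin k) ℝ) : Prop :=
  (∀ i, M i i = b (s + i)) ∧ (∀ i j : Fin k, (j : ℕ) = i + 1 → M i j * M j i = c (s + j)) ∧
    (∀ i j : Fin k, (i : ℕ) + 1 < j → M i j = 0 ∧ M j i = 0)

theorem IsTridiagWith.submatrix_succ {b c : ℕ → ℝ} {s k : ℕ}
    {M : Matrix (Fin (k + 1)) (Fin (k + 1)) ℝ} (hM : IsTridiagWith b c s M) :
    IsTridiagWith b c (s + 1) (M.submatrix Fin.succ Fin.succ) := by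
  obtain ⟨h₁, h₂, h₃⟩ := hM
  refine ⟨fun i => ?_, fun i j hij => ?_, fun i j hij => ?_⟩
  · simp [h₁, add_comm, add_left_comm]
  · simp [h₂ i.succ j.succ (by simpa using hij), add_comm, add_left_comm]
  · exact h₃ i.succ j.succ (by simpa using hij)

theorem Matrix.charmatrix_submatrix_of_injective {m n R : Type*} [DecidableEq m] [DecidableEq n]
    [Fintype m] [Fintype n] [CommRing R] (M : Matrix n n R) {f : m → n}
    (hf : Function.Injective f) :
    charmatrix (M.submatrix f f) = (charmatrix M).submatrix f f := by
  ext1 i j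
  by_cases h : i = j
  · subst h; simp [charmatrix_apply_eq]
  · simp [charmatrix_apply_ne, h, hf.ne h]

theorem IsTridiagWith.charpoly_eq {b c : ℕ → ℝ} {s k : ℕ} {M : Matrix (Fin k) (Fin k) ℝ}
    (hM : IsTridiagWith b c s M) : M.charpoly = jacobiPoly b c s (k + 1) := by
  induction k using Nat.strong_induction_on generalizing s with
  | _ k ih =>
    match k with
    | 0 => simp [Matrix.charpoly]
    | 1 =>
      have := hM.1 0
      simp_all [Matrix.charpoly, jacobiPoly_add_two b c s 0, charmatrix_apply_eq]
    | k + 2 =>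
      have e₁ := ih (k + 1) (by omega) hM.submatrix_succ
      have e₂ := ih k (by omega) hM.submatrix_succ.submatrix_succ
      rw [Matrix.charpoly, charmatrix_submatrix_of_injective _ (Fin.succ_injective _)] at e₁ e₂
      rw [charmatrix_submatrix_of_injective _ (Fin.succ_injective _)] at e₂
      obtain ⟨h₁, h₂, h₃⟩ := hM
      have z₁ : ∀ j : Fin k, charmatrix M 0 j.succ.succ = 0 := fun j => by
        rw [charmatrix_apply_ne _ _ _ (Fin.succ_ne_zero _).symm, (h₃ 0 j.succ.succ (by simp)).1]
        simp
      have z₂ : ∀ j : Fin k, charmatrix M j.succ.succ 0 = 0 := fun j => by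
        rw [charmatrix_apply_ne _ _ _ (Fin.succ_ne_zero _), (h₃ 0 j.succ.succ (by simp)).2]
        simp
      have hsub : ((charmatrix M).submatrix Fin.succ (Fin.succAbove 1)).det =
          charmatrix M 1 0 * jacobiPoly b c (s + 2) (k + 1) := by
        have hzero : (Fin.succAbove 1 0 : Fin (k + 2)) = 0 := by simp
        rw [det_succ_column_zero, Fin.sum_univ_succ, Finset.sum_eq_zero, ← e₂]
        · have hcols : (Fin.succAbove 1 ∘ Fin.succ : Fin k → Fin (k + 2)) =
              Fin.succ ∘ Fin.succ := by
            ext j; simp [Fin.succAbove, Fin.lt_def]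
          rw [submatrix_submatrix, submatrix_submatrix, hcols, submatrix_apply, hzero]
          simp only [Fin.val_zero, pow_zero, one_mul, Fin.succ_zero_eq_one, Fin.succAbove_zero,
            add_zero]
        · intro j _
          rw [submatrix_apply, hzero, z₂, mul_zero, zero_mul]
      have hc : charmatrix M 0 1 * charmatrix M 1 0 = C (c (s + 1)) := by
        rw [charmatrix_apply_ne _ _ _ (by simp), charmatrix_apply_ne _ _ _ (by simp),
          neg_mul_neg, ← C_mul, h₂ 0 1 (by simp)]
        simp
      rw [Matrix.charpoly, det_succ_row_zero, Fin.sum_univ_succ, Fin.sum_univ_succ,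
        Finset.sum_eq_zero (fun j _ => by simp [z₁]), jacobiPoly_add_two', ← hc]
      have h0 : charmatrix M 0 0 = X - C (b s) := by
        rw [charmatrix_apply_eq, h₁ 0]; simp
      simp only [Fin.succ_zero_eq_one, Fin.succAbove_zero, h0, hsub, e₁]
      simp
      ring

theorem Polynomial.Splits.eq_of_isRoot_iff {K : Type*} [Field K] {p q : K[X]} (hp : p.Splits)
    (hq : q.Splits) (hpm : p.Monic) (hqm : q.Monic) (hpn : p.roots.Nodup) (hqn : q.roots.Nodup)
    (h : ∀ x, p.IsRoot x ↔ q.IsRoot x) : p = q := by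
  rw [hp.eq_prod_roots_of_monic hpm, hq.eq_prod_roots_of_monic hqm,
    (Multiset.Nodup.ext hpn hqn).2 fun x => by
      rw [mem_roots hpm.ne_zero, mem_roots hqm.ne_zero, h]]

theorem Polynomial.Splits.isCoprime_of_no_common_root {K : Type*} [Field K] {p q : K[X]}
    (hp : p.Splits) (hp0 : p ≠ 0) (h : ∀ x, p.IsRoot x → ¬ q.IsRoot x) : IsCoprime p q := by
  refine isCoprime_of_irreducible_dvd (fun h' => hp0 h'.1) fun r hr hrp hrq => ?_
  obtain ⟨x, hx⟩ := (hp.of_dvd hp0 hrp).exists_eval_eq_zero hr.degree_pos.ne'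
  exact h x (IsRoot.dvd hx hrp) (IsRoot.dvd hx hrq)

theorem Matrix.IsSymm.splits_charpoly {n : Type*} [Fintype n] [DecidableEq n]
    {M : Matrix n n ℝ} (hM : M.IsSymm) : M.charpoly.Splits :=
  IsHermitian.splits_charpoly ((conjTranspose_eq_transpose_of_trivial M).trans hM)

theorem IsTridiagWith.jacobiPoly_eq_of_spectrum_eq {b c b' c' : ℕ → ℝ} {s k : ℕ}
    {M M' : Matrix (Fin k) (Fin k) ℝ} (hM : IsTridiagWith b c s M)
    (hM' : IsTridiagWith b' c' s M') (hs : M.IsSymm) (hs' : M'.IsSymm) (hc : ∀ i, 0 < c i)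
    (hc' : ∀ i, 0 < c' i) (h : spectrum ℝ M = spectrum ℝ M') :
    jacobiPoly b c s (k + 1) = jacobiPoly b' c' s (k + 1) := by
  have hsp : M.charpoly.Splits := hs.splits_charpoly
  have hsp' : M'.charpoly.Splits := hs'.splits_charpoly
  have hr : ∀ x, M.charpoly.IsRoot x ↔ M'.charpoly.IsRoot x := fun x => by
    rw [← mem_spectrum_iff_isRoot_charpoly, h, mem_spectrum_iff_isRoot_charpoly]
  rw [hM.charpoly_eq] at hsp hr
  rw [hM'.charpoly_eq] at hsp' hr
  exact hsp.eq_of_isRoot_iff hsp' (jacobiPoly_monic ..) (jacobiPoly_monic ..)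
    (jacobiPoly_roots_nodup hc ..) (jacobiPoly_roots_nodup hc' ..) hr

theorem eq_and_eq_of_isCoprime {P Q A A' B B' : ℝ[X]} {β β' : ℝ} (hPQ : IsCoprime P Q)
    (hA : A.degree < P.degree) (hA' : A'.degree < P.degree) (hB : B.degree < Q.degree)
    (hB' : B'.degree < Q.degree)
    (h : ((X - C β) * P - A) * Q - P * B = ((X - C β') * P - A') * Q - P * B') :
    β = β' ∧ A = A' ∧ B = B' := by
  have hAA : A - A' = 0 := by
    refine eq_zero_of_dvd_of_degree_lt (hPQ.dvd_of_dvd_mul_right (z := Q) ?_)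
      ((degree_sub_le A A').trans_lt (max_lt hA hA'))
    exact ⟨C (β' - β) * Q + B' - B, by rw [C_sub]; linear_combination -h⟩
  have hBB : B - B' = 0 := by
    refine eq_zero_of_dvd_of_degree_lt (hPQ.symm.dvd_of_dvd_mul_left (y := P) ?_)
      ((degree_sub_le B B').trans_lt (max_lt hB hB'))
    exact ⟨C (β' - β) * P + A' - A, by rw [C_sub]; linear_combination -h⟩
  have hP : P ≠ 0 := by rintro rfl; simp at hA
  have hQ : Q ≠ 0 := by rintro rfl; simp at hB
  have hβ : C (β' - β) * (P * Q) = 0 := by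
    rw [C_sub]; linear_combination h + hAA * Q + hBB * P
  have := (mul_eq_zero.1 hβ).resolve_right (mul_ne_zero hP hQ)
  exact ⟨(sub_eq_zero.1 (C_eq_zero.1 this)).symm, sub_eq_zero.1 hAA, sub_eq_zero.1 hBB⟩

/-- The polynomial of the index range `0, …, n + r`, together with those of the ranges below and
above `n`, determines the recurrence coefficients if the latter two are coprime. -/
theorem seq_eq_of_jacobiPoly_eq {b c b' c' : ℕ → ℝ} {n r : ℕ} (hc : ∀ i, 0 < c i)
    (hminus : jacobiPoly b c 0 (n + 1) = jacobiPoly b' c' 0 (n + 1))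
    (hplus : jacobiPoly b c (n + 1) (r + 1) = jacobiPoly b' c' (n + 1) (r + 1))
    (hfull : jacobiPoly b c 0 (n + 1 + r + 1) = jacobiPoly b' c' 0 (n + 1 + r + 1))
    (hcop : IsCoprime (jacobiPoly b c 0 (n + 1)) (jacobiPoly b c (n + 1) (r + 1))) :
    (∀ i < n + 1 + r, b i = b' i) ∧ ∀ i, 0 < i → i < n + 1 + r → c i = c' i := by
  rw [jacobiPoly_split _ _ _ (n + 1), jacobiPoly_split _ _ _ (n + 1), jacobiPoly_add_two,
    jacobiPoly_add_two] at hfull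
  simp only [zero_add] at hfull
  rw [← hminus, ← hplus] at hfull
  obtain ⟨hbn, hA, hB⟩ := eq_and_eq_of_isCoprime (β := b n) (β' := b' n)
    (A := C (c n) * jacobiPoly b c 0 n) (A' := C (c' n) * jacobiPoly b' c' 0 n)
    (B := C (c (n + 1)) * jacobiPoly b c (n + 1 + 1) r)
    (B' := C (c' (n + 1)) * jacobiPoly b' c' (n + 1 + 1) r) hcop
    (by rw [degree_jacobiPoly_succ]; exact degree_C_mul_jacobiPoly_lt ..)
    (by rw [degree_jacobiPoly_succ]; exact degree_C_mul_jacobiPoly_lt ..)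
    (by rw [degree_jacobiPoly_succ]; exact degree_C_mul_jacobiPoly_lt ..)
    (by rw [degree_jacobiPoly_succ]; exact degree_C_mul_jacobiPoly_lt ..)
    (by linear_combination hfull)
  obtain ⟨mb, mc, mγ⟩ := jacobiPoly_inverse hc 0 n (hc n) hminus hA
  obtain ⟨pb, pc, pγ⟩ := jacobiPoly_inverse' hc (n + 1) r (hc (n + 1)) hplus hB
  simp only [zero_add] at mb mc
  refine ⟨fun i hi => ?_, fun i hi0 hi => ?_⟩
  · rcases lt_trichotomy i n with h | rfl | h
    · exact mb i h
    · exact hbn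
    · obtain ⟨j, rfl⟩ := Nat.exists_eq_add_of_le (Nat.succ_le_of_lt h)
      exact pb j (by omega)
  · rcases lt_trichotomy i n with h | rfl | h
    · exact mc i hi0 h
    · exact mγ hi0
    · obtain ⟨j, rfl⟩ := Nat.exists_eq_add_of_le (Nat.succ_le_of_lt h)
      rcases j.eq_zero_or_pos with rfl | hj
      · exact pγ (by omega)
      · exact pc j hj (by omega)

section coefficients

variable {N : ℕ} (H : Matrix (Fin N) (Fin N) ℝ)

/-- The diagonal of `H`, extended by zero. -/
noncomputable def diagSeq (i : ℕ) : ℝ := if h : i < N then H ⟨i, h⟩ ⟨i, h⟩ else 0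

/-- The squares of the entries `H (i - 1) i`, extended by one. -/
noncomputable def offDiagSqSeq (i : ℕ) : ℝ :=
  if h : 0 < i ∧ i < N then H ⟨i - 1, by omega⟩ ⟨i, h.2⟩ ^ 2 else 1

variable {H}

theorem IsJacobi.offDiagSqSeq_pos (hH : IsJacobi H) (i : ℕ) : 0 < offDiagSqSeq H i := by
  unfold offDiagSqSeq
  split_ifs with h
  · exact pow_pos (hH.2.2 _ _ (by simp only; omega)) 2
  · exact one_pos

theorem IsJacobi.isTridiagWith_submatrix (hH : IsJacobi H) {s k : ℕ} {f : Fin k → Fin N}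
    (hf : ∀ i, (f i : ℕ) = s + i) :
    IsTridiagWith (diagSeq H) (offDiagSqSeq H) s (H.submatrix f f) := by
  obtain ⟨hs, h₀, -⟩ := hH
  refine ⟨fun i => ?_, fun i j hij => ?_, fun i j hij => ?_⟩
  · have := (f i).isLt
    simp [diagSeq, ← hf]
  · have hj := (f j).isLt
    have hi : f i = ⟨f j - 1, by omega⟩ := Fin.ext (by simp only [hf]; omega)
    have hpos : 0 < (f j : ℕ) := by rw [hf]; omega
    rw [← hf, offDiagSqSeq, dif_pos ⟨hpos, hj⟩, submatrix_apply, submatrix_apply,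
      hs.apply (f i) (f j), hi, sq]
  · have h := h₀ (f i) (f j) (by rw [hf, hf]; omega)
    exact ⟨h, (hs.apply (f i) (f j)).trans h⟩

theorem IsJacobi.eq_of_seq_eq {H' : Matrix (Fin N) (Fin N) ℝ} (hH : IsJacobi H)
    (hH' : IsJacobi H') (hb : ∀ i < N, diagSeq H i = diagSeq H' i)
    (hc : ∀ i, 0 < i → i < N → offDiagSqSeq H i = offDiagSqSeq H' i) : H = H' := by
  have hle : ∀ i j : Fin N, i ≤ j → H i j = H' i j := by
    intro i j hij
    rcases (show (i : ℕ) ≤ j from hij).lt_or_eq with hlt | heq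
    · rcases (Nat.succ_le_of_lt hlt).lt_or_eq with h | h
      · rw [hH.2.1 i j h, hH'.2.1 i j h]
      · have := hc j (by omega) j.isLt
        have hpos : 0 < (j : ℕ) ∧ (j : ℕ) < N := ⟨by omega, j.isLt⟩
        have hi : i = ⟨j - 1, by omega⟩ := Fin.ext (by simp only; omega)
        rw [offDiagSqSeq, offDiagSqSeq, dif_pos hpos, dif_pos hpos, ← hi] at this
        exact (sq_eq_sq₀ (hH.2.2 i j h.symm).le (hH'.2.2 i j h.symm).le).1 this
    · obtain rfl := Fin.ext heq
      simpa [diagSeq] using hb i i.isLt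
  ext i j
  rcases le_total i j with h | h
  · exact hle i j h
  · rw [← hH.1.apply, ← hH'.1.apply, hle j i h]

end coefficients

/-- Main uniqueness theorem: if two Jacobi matrices have the same spectrum,
and the blocks obtained by deleting row and column n have the same spectra,
and σ(H₋) ∩ σ(H₊) = ∅, then the matrices coincide. -/
theorem three_spectra_uniqueness {N : ℕ} (H H' : Matrix (Fin N) (Fin N) ℝ)
    (n : Fin N) (hH : IsJacobi H) (hH' : IsJacobi H')
    (hfull : spectrum ℝ H = spectrum ℝ H')
    (hminus : spectrum ℝ (Jminus H n) = spectrum ℝ (Jminus H' n))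
    (hplus : spectrum ℝ (Jplus H n) = spectrum ℝ (Jplus H' n))
    (hdisj : Disjoint (spectrum ℝ (Jminus H n)) (spectrum ℝ (Jplus H n))) :
    H = H' := by
  have hc := hH.offDiagSqSeq_pos
  have hc' := hH'.offDiagSqSeq_pos
  have tF : IsTridiagWith (diagSeq H) (offDiagSqSeq H) 0 H :=
    hH.isTridiagWith_submatrix (f := id) (by simp)
  have tF' : IsTridiagWith (diagSeq H') (offDiagSqSeq H') 0 H' :=
    hH'.isTridiagWith_submatrix (f := id) (by simp)
  have tm : IsTridiagWith (diagSeq H) (offDiagSqSeq H) 0 (Jminus H n) :=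
    hH.isTridiagWith_submatrix (by simp)
  have tm' : IsTridiagWith (diagSeq H') (offDiagSqSeq H') 0 (Jminus H' n) :=
    hH'.isTridiagWith_submatrix (by simp)
  have tp : IsTridiagWith (diagSeq H) (offDiagSqSeq H) (n + 1) (Jplus H n) :=
    hH.isTridiagWith_submatrix (by simp)
  have tp' : IsTridiagWith (diagSeq H') (offDiagSqSeq H') (n + 1) (Jplus H' n) :=
    hH'.isTridiagWith_submatrix (by simp)
  have eF := tF.jacobiPoly_eq_of_spectrum_eq tF' hH.1 hH'.1 hc hc' hfull
  have em := tm.jacobiPoly_eq_of_spectrum_eq tm' (hH.1.submatrix _) (hH'.1.submatrix _) hc hc'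
    hminus
  have ep := tp.jacobiPoly_eq_of_spectrum_eq tp' (hH.1.submatrix _) (hH'.1.submatrix _) hc hc'
    hplus
  have hcop : IsCoprime (jacobiPoly (diagSeq H) (offDiagSqSeq H) 0 (n + 1))
      (jacobiPoly (diagSeq H) (offDiagSqSeq H) (n + 1) (N - n - 1 + 1)) := by
    rw [← tm.charpoly_eq, ← tp.charpoly_eq]
    exact (hH.1.submatrix _ : (Jminus H n).IsSymm).splits_charpoly.isCoprime_of_no_common_root
      (charpoly_monic _).ne_zero fun x hx hx' => Set.disjoint_left.1 hdisj
        (mem_spectrum_iff_isRoot_charpoly.2 hx) (mem_spectrum_iff_isRoot_charpoly.2 hx')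
  have hn := n.isLt
  have hN : n + 1 + (N - n - 1) = N := by omega
  obtain ⟨hb, hcc⟩ := seq_eq_of_jacobiPoly_eq hc em ep (by rw [hN]; exact eF) hcop
  rw [hN] at hb hcc
  exact hH.eq_of_seq_eq hH' hb hcc
end

section
/- Let real numbers λ_1 < μ_1 < λ_2 < μ_2 < ... < μ_{N-1} < λ_N be given, together with a partition of {μ_1,...,μ_{N-1}} into two sets S_- of size n−1 and S_+ of size N−n. Then there exists a Jacobi matrix H (symmetric tridiagonal with positive off-diagonals) such that σ(H) = {λ_j}, σ(H_-) = S_-, and σ(H_+) = S_+, where H_± are the blocks obtained by deleting row and column n. -/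
open Matrix Polynomial BigOperators

/-- The residues of `∏ (X - lam j) / ∏ (X - mu i)` are negative when the data interlace. -/
theorem exists_secular_coeffs {M : ℕ} (lam : Fin (M + 1) → ℝ) (mu : Fin M → ℝ)
    (hlam : StrictMono lam) (hmu : StrictMono mu)
    (hint : ∀ j : Fin M, lam j.castSucc < mu j ∧ mu j < lam j.succ) :
    ∃ (b : ℝ) (a : Fin M → ℝ), (∀ i, 0 < a i) ∧ (∀ j i, lam j ≠ mu i) ∧
      ∀ j, lam j - b = ∑ i, a i / (lam j - mu i) := by
  have hne : ∀ j i, lam j ≠ mu i := by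
    intro j i
    rcases le_or_gt j i.castSucc with h | h
    · exact ((hlam.monotone h).trans_lt (hint i).1).ne
    · exact ((hint i).2.trans_le (hlam.monotone (Fin.castSucc_lt_iff_succ_le.mp h))).ne'
  set L : ℝ[X] := Lagrange.nodal Finset.univ lam with hL
  set Q : ℝ[X] := Lagrange.nodal Finset.univ mu with hQ
  have hQd : Q.natDegree = M := by simp [hQ, Lagrange.natDegree_nodal]
  have hLd : L.natDegree = M + 1 := by simp [hL, Lagrange.natDegree_nodal]
  have hQm : Q.Monic := Lagrange.nodal_monic
  have hLm : L.Monic := Lagrange.nodal_monic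
  set c : ℝ := (L - X * Q).coeff M with hc
  set q : ℝ[X] := L - X * Q - C c * Q with hq
  have hqd : q.degree < (Finset.univ : Finset (Fin M)).card := by
    rw [Finset.card_univ, Fintype.card_fin, degree_lt_iff_coeff_zero]
    intro k hk
    have hQM : Q.coeff M = 1 := by rw [← hQd]; exact hQm
    have hLM : L.coeff (M + 1) = 1 := by rw [← hLd]; exact hLm
    rcases hk.eq_or_lt with rfl | hk
    · rw [hq, coeff_sub, coeff_C_mul, hQM, ← hc]; ring
    · obtain ⟨k, rfl⟩ := Nat.exists_eq_add_of_lt hk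
      rw [hq, coeff_sub, coeff_C_mul, coeff_sub, coeff_X_mul,
        coeff_eq_zero_of_natDegree_lt (p := Q) (n := M + k + 1) (by omega)]
      rcases Nat.eq_zero_or_pos k with rfl | hk
      · simp [hQM, hLM]
      · rw [coeff_eq_zero_of_natDegree_lt (p := Q) (by omega),
          coeff_eq_zero_of_natDegree_lt (p := L) (by omega)]
        simp
  have hQmu : ∀ i, Q.eval (mu i) = 0 := fun i =>
    Lagrange.eval_nodal_at_node (Finset.mem_univ i)
  have hqmu : ∀ i, q.eval (mu i) = ∏ j, (mu i - lam j) := by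
    intro i
    simp [hq, hQmu, hL, Lagrange.eval_nodal]
  have hinterp := Lagrange.eq_interpolate (s := Finset.univ) (v := mu) hmu.injective.injOn hqd
  refine ⟨-c, fun i => -(Lagrange.nodalWeight Finset.univ mu i * q.eval (mu i)), ?_, hne, ?_⟩
  · intro i
    beta_reduce
    rw [hqmu, Fin.prod_univ_succAbove _ i.castSucc, ← Finset.mul_prod_erase _ _ (Finset.mem_univ i),
      Lagrange.nodalWeight, Fin.succAbove_castSucc_self]
    have hpos : 0 < (∏ j ∈ Finset.univ.erase i, (mu i - mu j)⁻¹) *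
        ∏ j ∈ Finset.univ.erase i, (mu i - lam (i.castSucc.succAbove j)) := by
      rw [← Finset.prod_mul_distrib]
      refine Finset.prod_pos fun j hj => ?_
      rcases lt_or_gt_of_ne (Finset.ne_of_mem_erase hj) with h | h
      · rw [Fin.succAbove_castSucc_of_lt _ _ h]
        have h1 := hmu h
        exact mul_pos (inv_pos.mpr (by linarith)) (by linarith [(hint j).1])
      · rw [Fin.succAbove_castSucc_of_le _ _ h.le]
        have h1 := hmu h
        exact mul_pos_of_neg_of_neg (inv_lt_zero.mpr (by linarith)) (by linarith [(hint j).2])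
    have h2 : 0 < (mu i - lam i.castSucc) * (lam i.succ - mu i) :=
      mul_pos (by linarith [(hint i).1]) (by linarith [(hint i).2])
    nlinarith [mul_pos hpos h2]
  · intro j
    have hQj : Q.eval (lam j) ≠ 0 := by
      rw [hQ, Lagrange.eval_nodal]
      exact Finset.prod_ne_zero_iff.mpr fun i _ => sub_ne_zero.mpr (hne j i)
    have hLj : L.eval (lam j) = 0 := Lagrange.eval_nodal_at_node (Finset.mem_univ j)
    have h1 : q.eval (lam j) = -(lam j + c) * Q.eval (lam j) := by
      simp [hq, hLj]; ring
    have h2 := congrArg (Polynomial.eval (lam j)) hinterp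
    rw [Lagrange.eval_interpolate_not_at_node _ (fun i _ => hne j i), h1, ← hQ, mul_comm] at h2
    have h3 := mul_left_cancel₀ hQj h2
    have h4 : lam j - -c = -(-(lam j + c)) := by ring
    rw [h4, h3, ← Finset.sum_neg_distrib]
    exact Finset.sum_congr rfl fun i _ => by ring

/-- Every nonzero vector is rotated onto the first coordinate axis by an orthogonal matrix. -/
theorem exists_orthogonal_mulVec_eq {k : ℕ} (v : Fin (k + 1) → ℝ) (hv : v ≠ 0) :
    ∃ O : Matrix (Fin (k + 1)) (Fin (k + 1)) ℝ, O * Oᵀ = 1 ∧ 0 < (O *ᵥ v) 0 ∧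
      ∀ i : Fin k, (O *ᵥ v) i.succ = 0 := by
  set x : EuclideanSpace ℝ (Fin (k + 1)) := WithLp.toLp 2 v with hx
  have hx0 : x ≠ 0 := fun h => hv (by simpa [hx] using h)
  have hn : 0 < ‖x‖ := norm_pos_iff.mpr hx0
  obtain ⟨e, he⟩ := Orthonormal.exists_orthonormalBasis_extension_of_card_eq
    (𝕜 := ℝ) (E := EuclideanSpace ℝ (Fin (k + 1))) (ι := Fin (k + 1)) (by simp)
    (v := fun _ => ‖x‖⁻¹ • x) (s := {0}) (by
      constructor
      · intro i
        simp [norm_smul, hn.ne']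
      · intro i j hij
        exact absurd (Subsingleton.elim i j) hij)
  have he0 := he 0 rfl
  have hin : ∀ y z : EuclideanSpace ℝ (Fin (k + 1)), y.ofLp ⬝ᵥ z.ofLp = inner ℝ y z := by
    intro y z
    simp [PiLp.inner_apply, dotProduct, mul_comm]
  have hxe : x = ‖x‖ • e 0 := by
    rw [he0, smul_smul, mul_inv_cancel₀ hn.ne', one_smul]
  have hor := orthonormal_iff_ite.mp e.orthonormal
  have hmv : ∀ i, ((Matrix.of fun i j => (e i).ofLp j) *ᵥ v) i = if i = 0 then ‖x‖ else 0 := by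
    intro i
    have : ((Matrix.of fun i j => (e i).ofLp j) *ᵥ v) i = inner ℝ (e i) x := (hin (e i) x)
    rw [this, hxe, inner_smul_right, hor]
    simp [norm_smul]
  refine ⟨Matrix.of fun i j => (e i).ofLp j, ?_, ?_, ?_⟩
  · ext i j
    rw [Matrix.one_apply, ← hor i j, ← hin]
    rfl
  · rw [hmv]; simpa using hn
  · intro i; rw [hmv]; simp [Fin.succ_ne_zero]

/-- Lanczos tridiagonalization: a symmetric matrix with a cyclic vector is orthogonally similar
to a Jacobi matrix, the cyclic vector going to a positive multiple of the first basis vector. -/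
theorem exists_orthogonal_isJacobi {k : ℕ} (A : Matrix (Fin k) (Fin k) ℝ) (v : Fin k → ℝ)
    (hA : A.IsSymm) (hv : ∀ (u : Fin k → ℝ) (t : ℝ), A *ᵥ u = t • u → u ⬝ᵥ v = 0 → u = 0) :
    ∃ U : Matrix (Fin k) (Fin k) ℝ, U * Uᵀ = 1 ∧ IsJacobi (U * A * Uᵀ) ∧
      ∀ i : Fin k, ((i : ℕ) = 0 → 0 < (U *ᵥ v) i) ∧ ((i : ℕ) ≠ 0 → (U *ᵥ v) i = 0) := by
  induction k with
  | zero =>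
    exact ⟨1, by simp, ⟨by ext i; exact i.elim0, fun i => i.elim0, fun i => i.elim0⟩,
      fun i => i.elim0⟩
  | succ k ih =>
    have hv0 : v ≠ 0 := by
      rintro rfl
      have hH : A.IsHermitian := by
        rw [Matrix.IsHermitian, Matrix.conjTranspose_eq_transpose_of_trivial]; exact hA
      have := hv _ _ (hH.mulVec_eigenvectorBasis 0) (by simp)
      have h1 := hH.eigenvectorBasis.orthonormal.ne_zero 0
      exact h1 (by ext i; exact congrFun this i)
    obtain ⟨O, hO, hO0, hOs⟩ := exists_orthogonal_mulVec_eq v hv0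
    have hO' : Oᵀ * O = 1 := mul_eq_one_comm.mp hO
    set B := O * A * Oᵀ with hB
    have hBs : B.IsSymm := by
      rw [Matrix.IsSymm, hB, Matrix.transpose_mul, Matrix.transpose_mul, hA.eq,
        Matrix.transpose_transpose, Matrix.mul_assoc]
    have hBij : ∀ i j, B i j = B j i := fun i j => hBs.apply j i
    obtain ⟨U, hU, hJ, hUw⟩ := ih (B.submatrix Fin.succ Fin.succ) (fun i => B i.succ 0)
      (by ext i j; exact hBij _ _) (by
        intro u t hu huw
        set z : Fin (k + 1) → ℝ := Fin.cons 0 u with hz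
        have hBz : B *ᵥ z = t • z := by
          ext i
          refine Fin.cases ?_ (fun i => ?_) i
          · have : (B *ᵥ z) 0 = u ⬝ᵥ fun i => B i.succ 0 := by
              simp only [Matrix.mulVec, dotProduct, Fin.sum_univ_succ, hz, Fin.cons_zero,
                Fin.cons_succ, mul_zero, zero_add]
              exact Finset.sum_congr rfl fun i _ => by rw [hBij 0 i.succ, mul_comm]
            rw [this, huw]; simp [hz]
          · have h1 := congrFun hu i
            simpa [Matrix.mulVec, dotProduct, Fin.sum_univ_succ, hz] using h1
        have h1 : A *ᵥ (Oᵀ *ᵥ z) = t • (Oᵀ *ᵥ z) := by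
          rw [← Matrix.mulVec_smul, ← hBz, hB, Matrix.mulVec_mulVec, Matrix.mulVec_mulVec,
            ← Matrix.mul_assoc, ← Matrix.mul_assoc, hO', Matrix.one_mul]
        have h2 : (Oᵀ *ᵥ z) ⬝ᵥ v = 0 := by
          rw [Matrix.mulVec_transpose, ← Matrix.dotProduct_mulVec]
          simp [dotProduct, Fin.sum_univ_succ, hz, hOs]
        have h3 := hv _ _ h1 h2
        have h4 : z = 0 := by
          rw [← Matrix.one_mulVec z, ← hO, ← Matrix.mulVec_mulVec, h3, Matrix.mulVec_zero]
        ext i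
        simpa [hz] using congrFun h4 i.succ)
    set E : Matrix (Fin (k + 1)) (Fin (k + 1)) ℝ :=
      Matrix.of (Fin.cons (Fin.cons 1 0) fun i => Fin.cons 0 (U i)) with hE
    have E00 : E 0 0 = 1 := rfl
    have E0s : ∀ j : Fin k, E 0 j.succ = 0 := fun _ => rfl
    have Es0 : ∀ j : Fin k, E j.succ 0 = 0 := fun _ => rfl
    have Ess : ∀ i j : Fin k, E i.succ j.succ = U i j := fun _ _ => rfl
    have hEE : E * Eᵀ = 1 := by
      ext i j
      rw [Matrix.mul_apply, Fin.sum_univ_succ]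
      refine Fin.cases ?_ (fun i => ?_) i <;> refine Fin.cases ?_ (fun j => ?_) j
      · simp [E00, E0s]
      · simp [E00, E0s, Es0, (Fin.succ_ne_zero j).symm]
      · simp [E0s, Es0]
      · have := congrFun (congrFun hU i) j
        rw [Matrix.mul_apply] at this
        simpa [Es0, Ess, Matrix.one_apply] using this
    have hconj : E * O * A * (E * O)ᵀ = E * B * Eᵀ := by
      rw [hB, Matrix.transpose_mul]
      simp only [Matrix.mul_assoc]
    have hsym : (E * B * Eᵀ).IsSymm := by
      rw [Matrix.IsSymm, Matrix.transpose_mul, Matrix.transpose_mul, hBs.eq,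
        Matrix.transpose_transpose, Matrix.mul_assoc E B]
    have hss : ∀ i j : Fin k, (E * B * Eᵀ) i.succ j.succ =
        (U * B.submatrix Fin.succ Fin.succ * Uᵀ) i j := by
      intro i j
      simp [Matrix.mul_apply, Fin.sum_univ_succ, Es0, Ess]
    have h0s : ∀ j : Fin k, (E * B * Eᵀ) 0 j.succ = (U *ᵥ fun i => B i.succ 0) j := by
      intro j
      rw [← hsym.apply]
      simp [Matrix.mul_apply, Fin.sum_univ_succ, Es0, Ess, E00, E0s, Matrix.mulVec, dotProduct]
    refine ⟨E * O, ?_, ?_, ?_⟩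
    · rw [Matrix.transpose_mul, Matrix.mul_assoc, ← Matrix.mul_assoc O, hO, Matrix.one_mul, hEE]
    · rw [hconj]
      refine ⟨hsym, fun i j => ?_, fun i j => ?_⟩
      · refine Fin.cases ?_ (fun i => ?_) i <;> refine Fin.cases ?_ (fun j => ?_) j
        · simp
        · intro h
          rw [h0s]
          exact (hUw j).2 (by simp at h; omega)
        · simp
        · intro h
          rw [hss]
          exact hJ.2.1 i j (by simpa using h)
      · refine Fin.cases ?_ (fun i => ?_) i <;> refine Fin.cases ?_ (fun j => ?_) j
        · simp
        · intro h
          rw [h0s]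
          exact (hUw j).1 (by simpa using h)
        · simp
        · intro h
          rw [hss]
          exact hJ.2.2 i j (by simpa using h)
    · intro i
      rw [← Matrix.mulVec_mulVec]
      refine Fin.cases ?_ (fun i => ?_) i
      · refine ⟨fun _ => ?_, fun h => absurd rfl h⟩
        simpa [Matrix.mulVec, dotProduct, Fin.sum_univ_succ (n := k) (fun x => E 0 x * _),
          E00, E0s] using hO0
      · refine ⟨fun h => by simp at h, fun _ => ?_⟩
        rw [Matrix.mulVec, dotProduct, Fin.sum_univ_succ]
        simp [Es0, hOs]

/-- Tridiagonalization of a diagonal matrix with simple spectrum. -/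
theorem exists_orthogonal_isJacobi_diagonal {k : ℕ} (d v : Fin k → ℝ)
    (hd : Function.Injective d) (hv : ∀ i, v i ≠ 0) :
    ∃ U : Matrix (Fin k) (Fin k) ℝ, U * Uᵀ = 1 ∧ IsJacobi (U * diagonal d * Uᵀ) ∧
      ∀ i : Fin k, ((i : ℕ) = 0 → 0 < (U *ᵥ v) i) ∧ ((i : ℕ) ≠ 0 → (U *ᵥ v) i = 0) := by
  refine exists_orthogonal_isJacobi _ v (Matrix.diagonal_transpose d) fun u t hu huv => ?_
  have h1 : ∀ i, u i ≠ 0 → d i = t := by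
    intro i hi
    have := congrFun hu i
    rw [Matrix.mulVec_diagonal] at this
    exact mul_right_cancel₀ hi this
  by_contra hne
  obtain ⟨i, hi⟩ := Function.ne_iff.mp hne
  have h2 : u ⬝ᵥ v = u i * v i := by
    refine Finset.sum_eq_single i (fun j _ hj => ?_) (by simp)
    by_contra h
    exact hj (hd ((h1 j (left_ne_zero_of_mul h)).trans (h1 i hi).symm))
  exact mul_ne_zero hi (hv i) (h2 ▸ huv)

theorem spectrum_orthogonal_conj {ι : Type*} [Fintype ι] [DecidableEq ι] (U A : Matrix ι ι ℝ)
    (hU : U * Uᵀ = 1) : spectrum ℝ (U * A * Uᵀ) = spectrum ℝ A :=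
  spectrum.units_conjugate (R := ℝ) (a := A) (u := ⟨U, Uᵀ, hU, mul_eq_one_comm.mp hU⟩)

theorem spectrum_submatrix_equiv {ι κ : Type*} [Fintype ι] [DecidableEq ι] [Fintype κ]
    [DecidableEq κ] (A : Matrix ι ι ℝ) (e : κ ≃ ι) :
    spectrum ℝ (A.submatrix e e) = spectrum ℝ A :=
  AlgEquiv.spectrum_eq (Matrix.reindexAlgEquiv ℝ ℝ e.symm) A

/-- A matrix of size `card ι` with `card ι` distinct eigenvalues has no further ones. -/
theorem spectrum_eq_range {ι κ : Type*} [Fintype ι] [DecidableEq ι] [Fintype κ]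
    (A : Matrix ι ι ℝ) (lam : κ → ℝ) (hlam : Function.Injective lam)
    (hcard : Fintype.card κ = Fintype.card ι)
    (h : ∀ j, ∃ x : ι → ℝ, x ≠ 0 ∧ A *ᵥ x = lam j • x) :
    spectrum ℝ A = Set.range lam := by
  classical
  have hs : spectrum ℝ A = ↑A.charpoly.roots.toFinset := by
    ext t
    rw [Matrix.mem_spectrum_iff_isRoot_charpoly]
    simp [A.charpoly_monic.ne_zero]
  have hsub : Finset.univ.image lam ⊆ A.charpoly.roots.toFinset := by
    intro t ht
    obtain ⟨j, -, rfl⟩ := Finset.mem_image.mp ht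
    obtain ⟨x, hx, hAx⟩ := h j
    rw [← Finset.mem_coe, ← hs, ← Matrix.spectrum_toLin']
    exact Module.End.HasEigenvalue.mem_spectrum
      (Module.End.hasEigenvalue_of_hasEigenvector
        (Module.End.hasEigenvector_iff.mpr
          ⟨Module.End.mem_eigenspace_iff.mpr (by simpa using hAx), hx⟩))
  have heq := Finset.eq_of_subset_of_card_le hsub (by
    rw [Finset.card_image_of_injective _ hlam, Finset.card_univ, hcard]
    exact (Multiset.toFinset_card_le _).trans
      ((Polynomial.card_roots' _).trans A.charpoly_natDegree_eq_dim.le))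
  rw [hs, ← heq]
  simp

/-- The bordered matrix with diagonal block `A`, border `v` and corner `b`. -/
def bordered {ι : Type*} (A : Matrix ι ι ℝ) (v : ι → ℝ) (b : ℝ) :
    Matrix (ι ⊕ Unit) (ι ⊕ Unit) ℝ :=
  Matrix.fromBlocks A (Matrix.of fun i _ => v i) (Matrix.of fun _ i => v i) (Matrix.of fun _ _ => b)

theorem spectrum_bordered_conj {ι : Type*} [Fintype ι] [DecidableEq ι] (U A : Matrix ι ι ℝ)
    (v : ι → ℝ) (b : ℝ) (hU : U * Uᵀ = 1) :
    spectrum ℝ (bordered (U * A * Uᵀ) (U *ᵥ v) b) = spectrum ℝ (bordered A v b) := by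
  rw [← spectrum_orthogonal_conj (Matrix.fromBlocks U 0 0 1) (bordered A v b)]
  · congr 1
    simp only [bordered, Matrix.fromBlocks_transpose, Matrix.fromBlocks_multiply]
    congr 1
    · simp
    · ext i j; simp [Matrix.mul_apply, Matrix.mulVec, dotProduct]
    · ext i j; simp [Matrix.mul_apply, Matrix.mulVec, dotProduct, mul_comm]
    · simp
  · simp [Matrix.fromBlocks_transpose, Matrix.fromBlocks_multiply, hU]

theorem spectrum_bordered_diagonal {ι κ : Type*} [Fintype ι] [DecidableEq ι] [Fintype κ]
    (d v : ι → ℝ) (b : ℝ) (lam : κ → ℝ) (hlam : Function.Injective lam)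
    (hcard : Fintype.card κ = Fintype.card ι + 1) (hne : ∀ j i, lam j ≠ d i)
    (h : ∀ j, lam j - b = ∑ i, v i ^ 2 / (lam j - d i)) :
    spectrum ℝ (bordered (diagonal d) v b) = Set.range lam := by
  refine spectrum_eq_range _ lam hlam (by simp [hcard]) fun j =>
    ⟨Sum.elim (fun i => v i / (lam j - d i)) 1, fun h0 => ?_, ?_⟩
  · simpa using congrFun h0 (Sum.inr ())
  · rw [bordered, Matrix.fromBlocks_mulVec]
    ext i
    rcases i with i | i
    · have := sub_ne_zero.mpr (hne j i)
      simp only [Sum.elim_inl, Sum.elim_comp_inl, Sum.elim_comp_inr, Pi.add_apply,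
        Matrix.mulVec_diagonal, Pi.smul_apply, smul_eq_mul]
      simp [Matrix.mulVec, dotProduct]
      field_simp
      ring
    · have : ∑ i, v i * (v i / (lam j - d i)) = lam j - b := by
        rw [h j]; exact Finset.sum_congr rfl fun i _ => by ring
      simp [Matrix.mulVec, dotProduct, this]

/-- Sites to the left of `n` in decreasing order, sites to the right in increasing order,
and the site `n` itself. -/
theorem exists_site_equiv {N : ℕ} (n : Fin N) :
    ∃ e : (Fin (n : ℕ) ⊕ Fin (N - (n : ℕ) - 1)) ⊕ Unit ≃ Fin N,
      (∀ i, (e (Sum.inl (Sum.inl i)) : ℕ) = n - 1 - i) ∧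
      (∀ i, (e (Sum.inl (Sum.inr i)) : ℕ) = n + 1 + i) ∧ (e (Sum.inr ()) : ℕ) = n := by
  have hn := n.isLt
  let f : (Fin (n : ℕ) ⊕ Fin (N - (n : ℕ) - 1)) ⊕ Unit → Fin N :=
    Sum.elim (Sum.elim (fun i => ⟨n - 1 - i, by omega⟩) fun i => ⟨n + 1 + i, by omega⟩) fun _ => n
  have hf : Function.Bijective f := by
    rw [Fintype.bijective_iff_injective_and_card]
    constructor
    · rintro ((i | i) | i) ((j | j) | j) h <;> simp [f, Fin.ext_iff] at h ⊢ <;> omega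
    · simp; omega
  exact ⟨Equiv.ofBijective f hf, fun _ => rfl, fun _ => rfl, rfl⟩

/-- Existence: given strictly interlacing data λ₁ < μ₁ < λ₂ < … < μ_{N-1} < λ_N
and a partition of the μ's into a set of size n (for H₋) and its complement
(for H₊), there is a Jacobi matrix with these three spectra. -/
theorem three_spectra_existence {N : ℕ} (n : Fin N)
    (lam : Fin N → ℝ) (mu : Fin (N - 1) → ℝ)
    (hlam : StrictMono lam) (hmu : StrictMono mu)
    (hint : ∀ j : Fin (N - 1), lam ⟨j, by have := j.isLt; omega⟩ < mu j ∧
      mu j < lam ⟨(j : ℕ) + 1, by have := j.isLt; omega⟩)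
    (P : Finset (Fin (N - 1))) (hP : P.card = (n : ℕ)) :
    ∃ H : Matrix (Fin N) (Fin N) ℝ, IsJacobi H ∧
      spectrum ℝ H = Set.range lam ∧
      spectrum ℝ (Jminus H n) = ↑(P.image mu) ∧
      spectrum ℝ (Jplus H n) = ↑(Pᶜ.image mu) := by
  obtain _ | M := N
  · exact n.elim0
  change Fin M → ℝ at mu
  change Finset (Fin M) at P
  obtain ⟨b, a, ha, hne, hsec⟩ := exists_secular_coeffs lam mu hlam hmu hint
  have hPc : Pᶜ.card = M + 1 - (n : ℕ) - 1 := by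
    rw [Finset.card_compl, hP, Fintype.card_fin]; omega
  let p : Fin (n : ℕ) ≃ P := (P.equivFinOfCardEq hP).symm
  let q : Fin (M + 1 - (n : ℕ) - 1) ≃ (Pᶜ : Finset (Fin M)) := (Pᶜ.equivFinOfCardEq hPc).symm
  obtain ⟨U, hU, hUJ, hUv⟩ := exists_orthogonal_isJacobi_diagonal
    (fun i => mu (p i)) (fun i => √(a (p i)))
    (hmu.injective.comp (Subtype.val_injective.comp p.injective))
    (fun i => (Real.sqrt_pos.mpr (ha _)).ne')
  obtain ⟨W, hW, hWJ, hWv⟩ := exists_orthogonal_isJacobi_diagonal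
    (fun i => mu (q i)) (fun i => √(a (q i)))
    (hmu.injective.comp (Subtype.val_injective.comp q.injective))
    (fun i => (Real.sqrt_pos.mpr (ha _)).ne')
  set d₁ : Fin (n : ℕ) → ℝ := fun i => mu (p i) with hd₁
  set d₂ : Fin (M + 1 - (n : ℕ) - 1) → ℝ := fun i => mu (q i) with hd₂
  set v₁ : Fin (n : ℕ) → ℝ := fun i => √(a (p i)) with hv₁
  set v₂ : Fin (M + 1 - (n : ℕ) - 1) → ℝ := fun i => √(a (q i)) with hv₂
  obtain ⟨e, he₁, he₂, he₀⟩ := exists_site_equiv n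
  set J₁ := U * diagonal d₁ * Uᵀ with hJ₁
  set J₂ := W * diagonal d₂ * Wᵀ with hJ₂
  set B := bordered (Matrix.fromBlocks J₁ 0 0 J₂) (Sum.elim (U *ᵥ v₁) (W *ᵥ v₂)) b with hB
  set H : Matrix (Fin (M + 1)) (Fin (M + 1)) ℝ := B.submatrix e.symm e.symm with hH
  have hHe : ∀ x y, H (e x) (e y) = B x y := fun x y => by simp [hH]
  have hBsymm : ∀ x y, B x y = B y x := by
    rintro ((x | x) | x) ((y | y) | y)
    · exact hUJ.1.apply y x
    · rfl
    · rfl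
    · rfl
    · exact hWJ.1.apply y x
    · rfl
    · rfl
    · rfl
    · rfl
  have hminus : Jminus H n = J₁.submatrix Fin.revPerm Fin.revPerm := by
    ext i j
    have key : ∀ i : Fin (n : ℕ), (⟨i, i.isLt.trans n.isLt⟩ : Fin (M + 1)) =
        e (Sum.inl (Sum.inl i.rev)) := fun i => by
      ext; rw [he₁, Fin.val_rev]; simp only; omega
    rw [Jminus, Matrix.submatrix_apply, key, key, hHe]
    rfl
  have hplus : Jplus H n = J₂ := by
    ext i j
    have key : ∀ (i : Fin (M + 1 - (n : ℕ) - 1)) (h : (n : ℕ) + 1 + i < M + 1),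
        (⟨(n : ℕ) + 1 + i, h⟩ : Fin (M + 1)) = e (Sum.inl (Sum.inr i)) := fun i h => by
      ext; rw [he₂]
    rw [Jplus, Matrix.submatrix_apply, key, key, hHe]
    rfl
  refine ⟨H, ⟨?_, ?_, ?_⟩, ?_, ?_, ?_⟩
  · ext i j
    exact hBsymm _ _
  · intro i j
    obtain ⟨x, rfl⟩ := e.surjective i
    obtain ⟨y, rfl⟩ := e.surjective j
    rw [hHe]
    rcases x with (x | x) | x <;> rcases y with (y | y) | y <;>
      simp only [he₁, he₂, he₀] <;> intro h
    · rw [hBsymm]; exact hUJ.2.1 y x (by omega)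
    · rfl
    · exact (hUv x).2 (by omega)
    · rfl
    · exact hWJ.2.1 x y (by omega)
    · omega
    · omega
    · exact (hWv y).2 (by omega)
    · omega
  · intro i j
    obtain ⟨x, rfl⟩ := e.surjective i
    obtain ⟨y, rfl⟩ := e.surjective j
    rw [hHe]
    rcases x with (x | x) | x <;> rcases y with (y | y) | y <;>
      simp only [he₁, he₂, he₀] <;> intro h
    · rw [hBsymm]; exact hUJ.2.2 y x (by omega)
    · omega
    · exact (hUv x).1 (by omega)
    · omega
    · exact hWJ.2.2 x y (by omega)
    · omega
    · omega
    · exact (hWv y).1 (by omega)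
    · omega
  · rw [hH, spectrum_submatrix_equiv]
    have hconj : B = bordered (Matrix.fromBlocks U 0 0 W * diagonal (Sum.elim d₁ d₂) *
        (Matrix.fromBlocks U 0 0 W)ᵀ) (Matrix.fromBlocks U 0 0 W *ᵥ Sum.elim v₁ v₂) b := by
      rw [hB, ← Matrix.fromBlocks_diagonal, Matrix.fromBlocks_transpose,
        Matrix.fromBlocks_multiply, Matrix.fromBlocks_multiply, Matrix.fromBlocks_mulVec]
      simp [hJ₁, hJ₂]
    rw [hconj, spectrum_bordered_conj]
    · refine spectrum_bordered_diagonal _ _ _ lam hlam.injective ?_ ?_ ?_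
      · simp; omega
      · rintro j (i | i) <;> exact hne _ _
      · intro j
        rw [hsec j, Fintype.sum_sum_type, ← Finset.sum_add_sum_compl P]
        have hsq : ∀ i, √(a i) ^ 2 = a i := fun i => Real.sq_sqrt (ha i).le
        congr 1
        · rw [← Finset.sum_coe_sort P, ← p.sum_comp]
          simp [hd₁, hv₁, hsq]
        · rw [← Finset.sum_coe_sort Pᶜ, ← q.sum_comp]
          simp [hd₂, hv₂, hsq]
    · simp [Matrix.fromBlocks_transpose, Matrix.fromBlocks_multiply, hU, hW]
  · rw [hminus, spectrum_submatrix_equiv, spectrum_orthogonal_conj _ _ hU,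
      spectrum_diagonal]
    have : d₁ = (fun x : P => mu x) ∘ p := rfl
    rw [this, p.surjective.range_comp, Finset.coe_image, Set.image_eq_range]
    rfl
  · rw [hplus, spectrum_orthogonal_conj _ _ hW, spectrum_diagonal]
    have : d₂ = (fun x : (Pᶜ : Finset (Fin M)) => mu x) ∘ q := rfl
    rw [this, q.surjective.range_comp, Finset.coe_image, Set.image_eq_range]
    rfl
end
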